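/- arXiv:1810.03894 — 2 statements merged into one kernel-verified Lean document; each statement's English description precedes it below -/
import Mathlib

section
/- Let G be an OTG with n ≥ 5 vertices and let C_w(G) be its weak closure. If h(G) = n − 2, then V(G) \ {x, y} is an H-force set of G of minimum cardinality, where x, y are vertices with degree n − 1 in C_w(G); if h(G) = n/2, then the largest independent set S of C_w(G) is an H-force set of G of minimum cardinality; if h(G) = n, then V(G) is the only H-force set of G. -/
open Finset SimpleGraph
open scoped Classical

/-- `X` is a Hamiltonian cycle enforcing set (H-force set) of `G`: `X` is nonempty and
every cycle of `G` containing all vertices of `X` is a Hamiltonian cycle. -/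
def IsHForceSet {V : Type*} [Fintype V] [DecidableEq V] (G : SimpleGraph V)
    (X : Finset V) : Prop :=
  X.Nonempty ∧ ∀ (v : V) (c : G.Walk v v), c.IsCycle → (∀ x ∈ X, x ∈ c.support) →
    c.IsHamiltonianCycle

/-- The H-force number of `G`: the smallest cardinality of an H-force set of `G`. -/
noncomputable def hForce {V : Type*} [Fintype V] [DecidableEq V] (G : SimpleGraph V) : ℕ :=
  sInf {k | ∃ X : Finset V, IsHForceSet G X ∧ X.card = k}

/-- `X` is an H-force set of `G` of minimum cardinality. -/
def IsMinHForceSet {V : Type*} [Fintype V] [DecidableEq V] (G : SimpleGraph V)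
    (X : Finset V) : Prop :=
  IsHForceSet G X ∧ ∀ Y : Finset V, IsHForceSet G Y → X.card ≤ Y.card

/-- `G` satisfies the condition of Ore's theorem: `d(u) + d(v) ≥ n` for every pair of
nonadjacent vertices `u, v`. -/
def IsOTG {V : Type*} [Fintype V] (G : SimpleGraph V) : Prop :=
  ∀ u v : V, u ≠ v → ¬G.Adj u v → Fintype.card V ≤ G.degree u + G.degree v

/-- One step of the weak-closure process: `H` is obtained from `G` by joining one pair of
nonadjacent vertices whose degree sum is at least `n + 1`. -/
def WeakStep {V : Type*} [Fintype V] (G H : SimpleGraph V) : Prop :=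
  ∃ u v : V, u ≠ v ∧ ¬G.Adj u v ∧ Fintype.card V + 1 ≤ G.degree u + G.degree v ∧
    H = G ⊔ SimpleGraph.edge u v

/-- `H` is a weak closure of `G`: it is obtained from `G` by a finite sequence of weak-closure
steps, and no pair of nonadjacent vertices of `H` has degree sum at least `n + 1`. -/
def IsWeakClosure {V : Type*} [Fintype V] (G H : SimpleGraph V) : Prop :=
  Relation.ReflTransGen WeakStep G H ∧
    ∀ u v : V, u ≠ v → ¬H.Adj u v → H.degree u + H.degree v < Fintype.card V + 1

/-- The first `k` terms of the sequence `p` are the successive vertices of a path of `G`. -/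
def IsSeqPath {V : Type*} (G : SimpleGraph V) (p : ℕ → V) (k : ℕ) : Prop :=
  (∀ i < k, ∀ j < k, p i = p j → i = j) ∧ ∀ i, i + 1 < k → G.Adj (p i) (p (i + 1))

namespace IsSeqPath

variable {V : Type*} {G : SimpleGraph V} {p : ℕ → V} {k : ℕ}

theorem reverse (h : IsSeqPath G p k) : IsSeqPath G (fun x => p (k - 1 - x)) k := by
  refine ⟨fun i hi j hj hij => ?_, fun i hi => ?_⟩
  · have := h.1 _ (by omega) _ (by omega) hij
    omega
  · have := h.2 (k - 1 - (i + 1)) (by omega)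
    rw [show k - 1 - (i + 1) + 1 = k - 1 - i by omega] at this
    exact this.symm

theorem rotate_start (h : IsSeqPath G p k) {i : ℕ} (hi : i + 1 < k)
    (hadj : G.Adj (p 0) (p (i + 1))) :
    IsSeqPath G (fun x => if x ≤ i then p (i - x) else p x) k := by
  refine ⟨fun a ha b hb hab => ?_, fun a ha => ?_⟩
  · dsimp only at hab
    split_ifs at hab
    all_goals
      have := h.1 _ (by omega) _ (by omega) hab
      omega
  · dsimp only
    split_ifs with h₁ h₂ h₂
    · have := h.2 (i - (a + 1)) (by omega)
      rw [show i - (a + 1) + 1 = i - a by omega] at this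
      exact this.symm
    · obtain rfl : a = i := by omega
      simpa using hadj
    · omega
    · exact h.2 a ha

theorem extend (h : IsSeqPath G p k) (hc : G.Adj (p (k - 1)) (p 0)) {q : V}
    (hq : ∀ i < k, p i ≠ q) {i : ℕ} (hi : i < k) (hadj : G.Adj q (p i)) :
    IsSeqPath G (fun x => if x = 0 then q else
      if i + x - 1 < k then p (i + x - 1) else p (i + x - 1 - k)) (k + 1) := by
  refine ⟨fun a ha b hb hab => ?_, fun a ha => ?_⟩
  · dsimp only at hab
    split_ifs at hab
    all_goals first
      | omega
      | exact absurd hab (hq _ (by omega))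
      | exact absurd hab.symm (hq _ (by omega))
      | (have := h.1 _ (by omega) _ (by omega) hab
         omega)
  · dsimp only
    rw [if_neg (Nat.succ_ne_zero a)]
    split_ifs with h₁ h₂ h₂ h₃ h₃
    · subst h₁
      simpa using hadj
    · omega
    · have := h.2 (i + a - 1) (by omega)
      rwa [show i + a - 1 + 1 = i + (a + 1) - 1 by omega] at this
    · rwa [show i + a - 1 = k - 1 by omega, show i + (a + 1) - 1 - k = 0 by omega]
    · omega
    · have := h.2 (i + a - 1 - k) (by omega)
      rwa [show i + a - 1 - k + 1 = i + (a + 1) - 1 - k by omega] at this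

/-- Degree count at the two ends of a path that admits no crossing pair of chords. -/
theorem degree_add_degree_le [Fintype V]
    (h0 : ∀ v, G.Adj (p 0) v → ∃ i < k - 1, p (i + 1) = v)
    (hl : ∀ v, G.Adj (p (k - 1)) v → ∃ i < k - 1, p i = v)
    (hX : ∀ i < k - 1, G.Adj (p 0) (p (i + 1)) → ¬G.Adj (p (k - 1)) (p i)) :
    G.degree (p 0) + G.degree (p (k - 1)) ≤
      ((range (k - 1)).filter
        fun i => G.Adj (p 0) (p (i + 1)) ∨ G.Adj (p (k - 1)) (p i)).card := by
  have e0 : G.degree (p 0) ≤ ((range (k - 1)).filter fun i => G.Adj (p 0) (p (i + 1))).card := by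
    rw [← G.card_neighborFinset_eq_degree]
    refine (card_le_card (t := ((range (k - 1)).filter
      fun i => G.Adj (p 0) (p (i + 1))).image fun i => p (i + 1)) fun v hv => ?_).trans
      card_image_le
    rw [mem_neighborFinset] at hv
    obtain ⟨i, hi, rfl⟩ := h0 v hv
    exact mem_image.2 ⟨i, by simp [hi, hv], rfl⟩
  have el : G.degree (p (k - 1)) ≤ ((range (k - 1)).filter fun i => G.Adj (p (k - 1)) (p i)).card := by
    rw [← G.card_neighborFinset_eq_degree]
    refine (card_le_card (t := ((range (k - 1)).filter
      fun i => G.Adj (p (k - 1)) (p i)).image p) fun v hv => ?_).trans card_image_le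
    rw [mem_neighborFinset] at hv
    obtain ⟨i, hi, rfl⟩ := hl v hv
    exact mem_image.2 ⟨i, by simp [hi, hv], rfl⟩
  rw [filter_or, card_union_of_disjoint]
  · omega
  · rw [disjoint_filter]
    exact fun i hi => hX i (mem_range.1 hi)

/-- Crossing chords at the ends of a path close it up to a cycle on the same vertices. -/
theorem close (h : IsSeqPath G p k) {i : ℕ} (hi : i < k - 1)
    (h₁ : G.Adj (p 0) (p (i + 1))) (h₂ : G.Adj (p (k - 1)) (p i)) :
    ∃ q, IsSeqPath G q k ∧ G.Adj (q (k - 1)) (q 0) ∧ ∀ x < k, ∃ y < k, q y = p x := by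
  refine ⟨_, h.rotate_start (by omega) h₁, ?_, fun x hx => ?_⟩
  · rw [if_neg (by omega)]
    simpa using h₂
  · by_cases hxi : x ≤ i
    · exact ⟨i - x, by omega, by simp [Nat.sub_sub_self hxi]⟩
    · exact ⟨x, hx, by simp [hxi]⟩

end IsSeqPath

section NearOre

variable {W : Type*} [Fintype W] {G : SimpleGraph W}

theorem IsSeqPath.card_le {p : ℕ → W} {k : ℕ} (h : IsSeqPath G p k) :
    k ≤ Fintype.card W := by
  have : ((range k).image p).card = k := by
    rw [card_image_of_injOn, card_range]
    exact fun i hi j hj => h.1 i (by simpa using hi) j (by simpa using hj)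
  exact this ▸ card_le_univ _

theorem IsSeqPath.exists_eq {p : ℕ → W} (h : IsSeqPath G p (Fintype.card W)) (v : W) :
    ∃ i < Fintype.card W, p i = v := by
  have : ((range (Fintype.card W)).image p) = univ := by
    rw [← card_eq_iff_eq_univ, card_image_of_injOn, card_range]
    exact fun i hi j hj => h.1 i (by simpa using hi) j (by simpa using hj)
  have hv := mem_univ v
  rw [← this] at hv
  simpa using hv

/-- Two nonadjacent vertices with degree sum at least `|W| - 1` have a common neighbour. -/
theorem exists_common_neighbor {u v : W} (huv : u ≠ v) (hadj : ¬G.Adj u v)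
    (hd : Fintype.card W ≤ G.degree u + G.degree v + 1) : ∃ x, G.Adj u x ∧ G.Adj v x := by
  by_contra! hno
  have hdis : Disjoint (G.neighborFinset u) (G.neighborFinset v) := by
    rw [Finset.disjoint_left]
    intro x hx hx'
    rw [mem_neighborFinset] at hx hx'
    exact hno x hx hx'
  have hsub : G.neighborFinset u ∪ G.neighborFinset v ⊆ (univ.erase u).erase v := by
    intro x hx
    rw [mem_union, mem_neighborFinset, mem_neighborFinset] at hx
    refine mem_erase.2 ⟨?_, mem_erase.2 ⟨?_, mem_univ _⟩⟩
    · rintro rfl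
      rcases hx with hx | hx
      · exact hadj hx
      · exact G.loopless.irrefl _ hx
    · rintro rfl
      rcases hx with hx | hx
      · exact G.loopless.irrefl _ hx
      · exact hadj hx.symm
  have h1 := card_le_card hsub
  rw [card_union_of_disjoint hdis, card_erase_of_mem (by simp [huv.symm]),
    card_erase_of_mem (mem_univ _), card_univ, G.card_neighborFinset_eq_degree,
    G.card_neighborFinset_eq_degree] at h1
  have : 2 ≤ Fintype.card W := by
    rw [← card_pair huv]
    exact card_le_univ _
  omega

theorem exists_longer_seqPath
    (hd : ∀ u v : W, u ≠ v → ¬G.Adj u v → Fintype.card W ≤ G.degree u + G.degree v + 1)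
    {p : ℕ → W} {k : ℕ} (hk : 1 ≤ k) (hkW : k < Fintype.card W) (h : IsSeqPath G p k) :
    ∃ q, IsSeqPath G q (k + 1) := by
  by_contra hno
  have hstart : ∀ p', IsSeqPath G p' k → ∀ v, G.Adj (p' 0) v → ∃ i < k, p' i = v := by
    intro p' hp' v hv
    by_contra! hout
    refine hno ⟨fun x => if x = 0 then v else p' (x - 1), ?_, ?_⟩
    · intro a ha b hb hab
      dsimp only at hab
      split_ifs at hab
      · omega
      · exact absurd hab.symm (hout _ (by omega))
      · exact absurd hab (hout _ (by omega))
      · have := hp'.1 _ (by omega) _ (by omega) hab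
        omega
    · intro a ha
      rcases Nat.eq_zero_or_pos a with rfl | ha0
      · simpa using hv.symm
      · have := hp'.2 (a - 1) (by omega)
        rw [Nat.sub_add_cancel ha0] at this
        simpa [ha0.ne'] using this
  obtain ⟨q, hq⟩ : ∃ q, ∀ i < k, p i ≠ q := by
    by_contra! hall
    have := card_le_card (s := univ) (t := (range k).image p) fun v _ => by simpa using hall v
    have := card_image_le (s := range k) (f := p)
    simp only [card_univ, card_range] at *
    omega
  have hnocyc : ∀ p', IsSeqPath G p' k → (∀ x < k, ∃ y < k, p' y = p x) →
      ¬G.Adj (p' (k - 1)) (p' 0) := by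
    intro p' hp' hsup hc
    have hq' : ∀ i < k, p' i ≠ q := by
      have himg : (range k).image p = (range k).image p' := by
        refine eq_of_subset_of_card_le (fun v hv => ?_) ?_
        · simp only [mem_image, mem_range] at hv ⊢
          obtain ⟨x, hx, rfl⟩ := hv
          exact hsup x hx
        · refine card_image_le.trans (le_of_eq ?_)
          rw [card_image_of_injOn]
          exact fun i hi j hj => h.1 i (by simpa using hi) j (by simpa using hj)
      intro i hi hiq
      have : q ∈ (range k).image p := himg ▸ mem_image.2 ⟨i, by simpa using hi, hiq⟩
      simp only [mem_image, mem_range] at this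
      obtain ⟨j, hj, hjq⟩ := this
      exact hq j hj hjq
    have hna : ¬G.Adj q (p' 0) := fun hadj => hno ⟨_, hp'.extend hc hq' hk hadj⟩
    obtain ⟨x, hqx, hx⟩ := exists_common_neighbor (hq' 0 hk).symm hna (hd _ _ (hq' 0 hk).symm hna)
    obtain ⟨i, hi, rfl⟩ := hstart p' hp' x hx
    exact hno ⟨_, hp'.extend hc hq' hi hqx⟩
  have hk2 : 2 ≤ k := by
    have hna : ¬G.Adj (p 0) q := fun hadj => by
      obtain ⟨i, hi, h'⟩ := hstart p h q hadj
      exact hq i hi h'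
    obtain ⟨x, hx, -⟩ := exists_common_neighbor (hq 0 hk) hna (hd _ _ (hq 0 hk) hna)
    obtain ⟨i, hi, rfl⟩ := hstart p h x hx
    rcases Nat.eq_zero_or_pos i with rfl | hi0
    · exact absurd hx (G.loopless.irrefl _)
    · omega
  have hne : p 0 ≠ p (k - 1) := fun he => by
    have := h.1 _ (by omega) _ (by omega) he
    omega
  have hnadj := hnocyc p h fun x hx => ⟨x, hx, rfl⟩
  have := hd _ _ hne fun hadj => hnadj hadj.symm
  have hle := IsSeqPath.degree_add_degree_le (G := G) (p := p) (k := k) ?_ ?_ ?_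
  · have h' := hle.trans (card_filter_le _ _)
    rw [card_range] at h'
    omega
  · intro v hv
    obtain ⟨i, hi, rfl⟩ := hstart p h v hv
    rcases Nat.eq_zero_or_pos i with rfl | hi0
    · exact absurd hv (G.loopless.irrefl _)
    · exact ⟨i - 1, by omega, by rw [Nat.sub_add_cancel hi0]⟩
  · intro v hv
    obtain ⟨i, hi, hiv⟩ := hstart _ h.reverse v (by simpa using hv)
    rcases Nat.eq_zero_or_pos i with rfl | hi0
    · rw [← hiv] at hv
      exact absurd hv (G.loopless.irrefl _)
    · exact ⟨k - 1 - i, by omega, hiv⟩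
  · intro i hi h₁ h₂
    obtain ⟨q', hq', hc, hsup⟩ := h.close hi h₁ h₂
    exact hnocyc q' hq' hsup hc

theorem exists_hamiltonian_seqPath [Nonempty W]
    (hd : ∀ u v : W, u ≠ v → ¬G.Adj u v → Fintype.card W ≤ G.degree u + G.degree v + 1) :
    ∃ p, IsSeqPath G p (Fintype.card W) := by
  have key : ∀ k, 1 ≤ k → k ≤ Fintype.card W → ∃ p, IsSeqPath G p k := by
    intro k hk
    induction k, hk using Nat.le_induction with
    | base =>
      exact fun _ => ⟨fun _ => Classical.arbitrary W, fun i hi j hj _ => by omega,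
        fun i hi => by omega⟩
    | succ k hk ih =>
      intro hkW
      obtain ⟨p, hp⟩ := ih (by omega)
      exact exists_longer_seqPath hd hk (by omega) hp
  exact key _ Fintype.card_pos le_rfl

/-- If no cycle spans the graph, then each step of a spanning path is used by exactly one of the
two ends. -/
theorem IsSeqPath.adj_start_iff
    (hd : ∀ u v : W, u ≠ v → ¬G.Adj u v → Fintype.card W ≤ G.degree u + G.degree v + 1)
    (hW : 2 ≤ Fintype.card W)
    (hno : ∀ q, IsSeqPath G q (Fintype.card W) → ¬G.Adj (q (Fintype.card W - 1)) (q 0))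
    {p : ℕ → W} (h : IsSeqPath G p (Fintype.card W)) {i : ℕ} (hi : i < Fintype.card W - 1) :
    G.Adj (p 0) (p (i + 1)) ↔ ¬G.Adj (p (Fintype.card W - 1)) (p i) := by
  have hX : ∀ i < Fintype.card W - 1, G.Adj (p 0) (p (i + 1)) →
      ¬G.Adj (p (Fintype.card W - 1)) (p i) := by
    intro i hi h₁ h₂
    obtain ⟨q, hq, hc, -⟩ := h.close hi h₁ h₂
    exact hno q hq hc
  refine ⟨hX i hi, fun hB => ?_⟩
  by_contra hA
  have hne : p 0 ≠ p (Fintype.card W - 1) := fun he => by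
    have := h.1 _ (by omega) _ (by omega) he
    omega
  have := hd _ _ hne fun hadj => hno p h hadj.symm
  have hle := IsSeqPath.degree_add_degree_le (G := G) (p := p) (k := Fintype.card W) ?_ ?_ hX
  · have hlt : ((range (Fintype.card W - 1)).filter fun i => G.Adj (p 0) (p (i + 1)) ∨
        G.Adj (p (Fintype.card W - 1)) (p i)).card < (range (Fintype.card W - 1)).card :=
      card_lt_card (filter_ssubset.2 ⟨i, mem_range.2 hi, by tauto⟩)
    rw [card_range] at hlt
    omega
  · intro v hv
    obtain ⟨i, hi, rfl⟩ := h.exists_eq v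
    rcases Nat.eq_zero_or_pos i with rfl | hi0
    · exact absurd hv (G.loopless.irrefl _)
    · exact ⟨i - 1, by omega, by rw [Nat.sub_add_cancel hi0]⟩
  · intro v hv
    obtain ⟨i, hi, rfl⟩ := h.exists_eq v
    refine ⟨i, ?_, rfl⟩
    by_contra hlt
    rw [show i = Fintype.card W - 1 by omega] at hv
    exact absurd hv (G.loopless.irrefl _)

theorem IsSeqPath.adj_iff_of_add_two_le
    (hd : ∀ u v : W, u ≠ v → ¬G.Adj u v → Fintype.card W ≤ G.degree u + G.degree v + 1)
    (hW : 2 ≤ Fintype.card W)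
    (hno : ∀ q, IsSeqPath G q (Fintype.card W) → ¬G.Adj (q (Fintype.card W - 1)) (q 0))
    {p : ℕ → W} (h : IsSeqPath G p (Fintype.card W)) {i j : ℕ}
    (hi : G.Adj (p 0) (p (i + 1))) (hij : i + 2 ≤ j) (hj : j < Fintype.card W) :
    G.Adj (p i) (p j) ↔ G.Adj (p 0) (p j) := by
  have h₁ := (h.rotate_start (by omega) hi).adj_start_iff hd hW hno (i := j - 1) (by omega)
  have h₂ := h.adj_start_iff hd hW hno (i := j - 1) (by omega)
  rw [Nat.sub_add_cancel (by omega)] at h₁ h₂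
  rw [if_pos (Nat.zero_le _), if_neg (by omega), if_neg (by omega), if_neg (by omega),
    Nat.sub_zero] at h₁
  rw [h₁, h₂]

theorem IsSeqPath.adj_iff_of_lt
    (hd : ∀ u v : W, u ≠ v → ¬G.Adj u v → Fintype.card W ≤ G.degree u + G.degree v + 1)
    (hW : 2 ≤ Fintype.card W)
    (hno : ∀ q, IsSeqPath G q (Fintype.card W) → ¬G.Adj (q (Fintype.card W - 1)) (q 0))
    {p : ℕ → W} (h : IsSeqPath G p (Fintype.card W)) {i j : ℕ}
    (hi : G.Adj (p 0) (p (i + 1))) (hji : j < i) (hiW : i + 1 < Fintype.card W) :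
    G.Adj (p i) (p j) ↔ G.Adj (p 0) (p (j + 2)) := by
  have h₁ := (h.rotate_start hiW hi).adj_start_iff hd hW hno (i := i - j - 1) (by omega)
  have h₂ := h.adj_start_iff hd hW hno (i := j + 1) (by omega)
  rw [if_pos (Nat.zero_le _), if_pos (by omega), if_neg (by omega), if_pos (by omega),
    Nat.sub_zero, show i - (i - j - 1 + 1) = j by omega, show i - (i - j - 1) = j + 1 by omega]
    at h₁
  rw [h₁, h₂]

/-- If the neighbours of the start do not form an initial segment of the path, then no two of them
are consecutive on the path. -/
theorem IsSeqPath.not_adj_start_consecutive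
    (hd : ∀ u v : W, u ≠ v → ¬G.Adj u v → Fintype.card W ≤ G.degree u + G.degree v + 1)
    (hW : 2 ≤ Fintype.card W)
    (hno : ∀ q, IsSeqPath G q (Fintype.card W) → ¬G.Adj (q (Fintype.card W - 1)) (q 0))
    {p : ℕ → W} (h : IsSeqPath G p (Fintype.card W)) {j : ℕ} (hj : j + 2 < Fintype.card W)
    (hj₁ : ¬G.Adj (p 0) (p (j + 1))) (hj₂ : G.Adj (p 0) (p (j + 2))) {i : ℕ}
    (hi : i + 2 < Fintype.card W) (hi₁ : G.Adj (p 0) (p (i + 1))) :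
    ¬G.Adj (p 0) (p (i + 2)) := by
  have key : ∀ a b, a < b → b + 1 < Fintype.card W → G.Adj (p 0) (p (a + 1)) →
      G.Adj (p 0) (p (b + 1)) → (G.Adj (p 0) (p b) ↔ G.Adj (p 0) (p (a + 2))) := by
    intro a b hab hb ha' hb'
    rcases Nat.lt_or_ge (a + 1) b with hlt | hge
    · rw [← h.adj_iff_of_add_two_le hd hW hno ha' hlt (by omega),
        ← h.adj_iff_of_lt hd hW hno hb' hab hb, G.adj_comm]
    · obtain rfl : b = a + 1 := by omega
      exact iff_of_true ha' hb'
  have h01 : G.Adj (p 0) (p (0 + 1)) := h.2 0 (by omega)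
  have h02 : ¬G.Adj (p 0) (p (0 + 2)) := by
    rw [← key 0 (j + 1) (by omega) hj h01 hj₂]
    exact hj₁
  intro hi₂
  rcases Nat.eq_zero_or_pos i with rfl | hi0
  · exact h02 hi₂
  · exact h02 ((key 0 (i + 1) (by omega) hi h01 hi₂).1 hi₁)

/-- A graph whose nonadjacent vertices have degree sum at least `|W| - 1` has a spanning cycle,
a large independent set, or a cut vertex. -/
theorem exists_cycle_or_indep_or_cut (hW : 2 ≤ Fintype.card W)
    (hd : ∀ u v : W, u ≠ v → ¬G.Adj u v → Fintype.card W ≤ G.degree u + G.degree v + 1) :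
    (∃ q, IsSeqPath G q (Fintype.card W) ∧ G.Adj (q (Fintype.card W - 1)) (q 0)) ∨
    (∃ S : Finset W, (∀ x ∈ S, ∀ y ∈ S, ¬G.Adj x y) ∧ Fintype.card W + 1 ≤ 2 * S.card) ∨
    ∃ (z : W) (A B : Finset W), A.Nonempty ∧ B.Nonempty ∧ Disjoint A B ∧ z ∉ A ∧ z ∉ B ∧
      (∀ x, x = z ∨ x ∈ A ∨ x ∈ B) ∧ ∀ a ∈ A, ∀ b ∈ B, ¬G.Adj a b := by
  refine or_iff_not_imp_left.2 fun hno => ?_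
  push Not at hno
  have : Nonempty W := Fintype.card_pos_iff.1 (by omega)
  obtain ⟨p, h⟩ := exists_hamiltonian_seqPath hd
  set N := Fintype.card W
  have hlast : ¬G.Adj (p 0) (p (N - 1)) := fun hadj => hno p h hadj.symm
  by_cases hinit : ∃ j, j + 2 < N ∧ ¬G.Adj (p 0) (p (j + 1)) ∧ G.Adj (p 0) (p (j + 2))
  · left
    obtain ⟨j, hj, hj₁, hj₂⟩ := hinit
    have hA : ∀ i, i + 2 < N → G.Adj (p 0) (p (i + 1)) → ¬G.Adj (p 0) (p (i + 2)) :=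
      fun i hi => h.not_adj_start_consecutive hd hW hno hj hj₁ hj₂ hi
    have hpart : ∀ i < N - 1, (G.Adj (p 0) (p (i + 1)) ↔ ¬G.Adj (p (N - 1)) (p i)) :=
      fun i hi => h.adj_start_iff hd hW hno hi
    have hB : ∀ i, i + 2 < N → ¬G.Adj (p 0) (p (i + 1)) → G.Adj (p 0) (p (i + 2)) := by
      intro i hi hi₁
      by_contra hi₂
      rw [hpart _ (by omega), not_not] at hi₁ hi₂ hj₁
      rw [hpart _ (by omega)] at hj₂
      have := h.reverse.not_adj_start_consecutive hd hW hno (j := N - 3 - j) (by omega)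
        (by rwa [Nat.sub_zero, show N - 1 - (N - 3 - j + 1) = j + 1 by omega])
        (by rwa [Nat.sub_zero, show N - 1 - (N - 3 - j + 2) = j by omega])
        (i := N - 3 - i) (by omega)
        (by rwa [Nat.sub_zero, show N - 1 - (N - 3 - i + 1) = i + 1 by omega])
      rw [Nat.sub_zero, show N - 1 - (N - 3 - i + 2) = i by omega] at this
      exact this hi₁
    set A := (range (N - 1)).filter fun i => G.Adj (p 0) (p (i + 1)) with hAdef
    set B := (range (N - 1)).filter fun i => ¬G.Adj (p 0) (p (i + 1)) with hBdef
    have hcard : A.card + B.card = N - 1 := by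
      rw [hAdef, hBdef, card_filter_add_card_filter_not, card_range]
    have hBA : B.card ≤ A.card := by
      refine card_le_card_of_injOn (fun i => i - 1) (fun i hi => ?_) ?_
      · simp only [hBdef, hAdef, coe_filter, mem_range, Set.mem_ofPred_eq] at hi ⊢
        have hi0 : i ≠ 0 := by
          rintro rfl
          exact hi.2 (h.2 0 (by omega))
        refine ⟨by omega, ?_⟩
        by_contra hc
        have := hB (i - 1) (by omega) hc
        rw [show i - 1 + 2 = i + 1 by omega] at this
        exact hi.2 this
      · intro a ha b hb hab
        simp only [hBdef, coe_filter, mem_range, Set.mem_ofPred_eq] at ha hb hab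
        have ha0 : a ≠ 0 := by
          rintro rfl
          exact ha.2 (h.2 0 (by omega))
        have hb0 : b ≠ 0 := by
          rintro rfl
          exact hb.2 (h.2 0 (by omega))
        omega
    have hlt : ∀ x ∈ insert (N - 1) A, ∀ y ∈ insert (N - 1) A, x < y → ¬G.Adj (p x) (p y) := by
      intro x hx y hy hxy
      simp only [hAdef, mem_insert, mem_filter, mem_range] at hx hy
      have hx' : x < N - 1 ∧ G.Adj (p 0) (p (x + 1)) := by
        rcases hx with rfl | hx
        · omega
        · exact hx
      rcases hy with rfl | hy
      · rw [G.adj_comm]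
        exact (hpart x hx'.1).1 hx'.2
      · have h2 : x + 2 ≤ y := by
          by_contra hc
          obtain rfl : y = x + 1 := by omega
          exact hA x (by omega) hx'.2 hy.2
        rw [h.adj_iff_of_add_two_le hd hW hno hx'.2 h2 (by omega)]
        intro hc
        have := hA (y - 1) (by omega) (by rwa [show y - 1 + 1 = y by omega])
        rw [show y - 1 + 2 = y + 1 by omega] at this
        exact this hy.2
    refine ⟨(insert (N - 1) A).image p, ?_, ?_⟩
    · intro x hx y hy
      obtain ⟨a, ha, rfl⟩ := mem_image.1 hx
      obtain ⟨b, hb, rfl⟩ := mem_image.1 hy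
      rcases lt_trichotomy a b with hab | rfl | hab
      · exact hlt a ha b hb hab
      · exact G.loopless.irrefl _
      · rw [G.adj_comm]
        exact hlt b hb a ha hab
    · rw [card_image_of_injOn, card_insert_of_notMem]
      · omega
      · simp [hAdef]
      · intro a ha b hb hab
        simp only [hAdef, coe_insert, coe_filter, mem_range, Set.mem_insert_iff,
          Set.mem_ofPred_eq] at ha hb
        exact h.1 a (by omega) b (by omega) hab
  · right
    push Not at hinit
    have hex : ∃ K, ¬G.Adj (p 0) (p (K + 1)) :=
      ⟨N - 2, by rwa [show N - 2 + 1 = N - 1 by omega]⟩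
    set K := Nat.find hex with hK
    have hKspec : ¬G.Adj (p 0) (p (K + 1)) := Nat.find_spec hex
    have hKmin : ∀ i < K, G.Adj (p 0) (p (i + 1)) := fun i hi => not_not.1 (Nat.find_min hex hi)
    have hKle : K ≤ N - 2 :=
      Nat.find_min' hex (by rwa [show N - 2 + 1 = N - 1 by omega])
    have hK0 : 0 < K := by
      by_contra hc
      rw [show K = 0 by omega] at hKspec
      exact hKspec (h.2 0 (by omega))
    have hafter : ∀ j, K + 1 ≤ j → j < N → ¬G.Adj (p 0) (p j) := by
      intro j hj
      induction j, hj using Nat.le_induction with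
      | base => exact fun _ => hKspec
      | succ j hj ih =>
        intro hjN
        have := hinit (j - 1) (by omega)
        rw [show j - 1 + 1 = j by omega, show j - 1 + 2 = j + 1 by omega] at this
        exact this (ih (by omega))
    refine ⟨p K, (range K).image p, (Ico (K + 1) N).image p, ?_, ?_, ?_, ?_, ?_, ?_, ?_⟩
    · simpa using hK0.ne'
    · simp only [image_nonempty, nonempty_Ico]
      omega
    · rw [Finset.disjoint_left]
      intro x hx hx'
      simp only [mem_image, mem_range, mem_Ico] at hx hx'
      obtain ⟨a, ha, rfl⟩ := hx
      obtain ⟨b, hb, hab⟩ := hx'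
      have := h.1 b (by omega) a (by omega) hab
      omega
    · simp only [mem_image, mem_range, not_exists, not_and]
      intro a ha hab
      have := h.1 a (by omega) K (by omega) hab
      omega
    · simp only [mem_image, mem_Ico, not_exists, not_and]
      intro a ha hab
      have := h.1 a (by omega) K (by omega) hab
      omega
    · intro x
      obtain ⟨i, hi, rfl⟩ := h.exists_eq x
      simp only [mem_image, mem_range, mem_Ico]
      rcases lt_trichotomy i K with hiK | rfl | hiK
      · exact Or.inr (Or.inl ⟨i, hiK, rfl⟩)
      · exact Or.inl rfl
      · exact Or.inr (Or.inr ⟨i, ⟨hiK, hi⟩, rfl⟩)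
    · intro a ha b hb
      simp only [mem_image, mem_range, mem_Ico] at ha hb
      obtain ⟨a, ha, rfl⟩ := ha
      obtain ⟨b, hb, rfl⟩ := hb
      rw [h.adj_iff_of_add_two_le hd hW hno (hKmin a ha) (by omega) hb.2]
      exact hafter b hb.1 hb.2

end NearOre

section Walks

variable {V : Type*} {G : SimpleGraph V}

theorem IsSeqPath.exists_walk {p : ℕ → V} {k : ℕ} (h : IsSeqPath G p k) {m : ℕ} (hm : m < k) :
    ∃ c : G.Walk (p 0) (p m), c.support = (List.range (m + 1)).map p := by
  induction m with
  | zero => exact ⟨.nil, by simp⟩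
  | succ m ih =>
    obtain ⟨c, hc⟩ := ih (by omega)
    refine ⟨c.concat (h.2 m hm), ?_⟩
    rw [Walk.support_concat, hc, List.range_succ (n := m + 1)]
    simp

theorem IsSeqPath.exists_cycle {p : ℕ → V} {k : ℕ} (h : IsSeqPath G p k) (hk : 3 ≤ k)
    (hc : G.Adj (p (k - 1)) (p 0)) :
    ∃ c : G.Walk (p (k - 1)) (p (k - 1)), c.IsCycle ∧ ∀ x, x ∈ c.support ↔ ∃ i < k, p i = x := by
  obtain ⟨c, hs⟩ := h.exists_walk (m := k - 1) (by omega)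
  rw [Nat.sub_add_cancel (by omega)] at hs
  have hpath : c.IsPath := by
    rw [Walk.isPath_def, hs]
    refine List.Nodup.map_on (fun i hi j hj => ?_) List.nodup_range
    exact h.1 i (List.mem_range.1 hi) j (List.mem_range.1 hj)
  refine ⟨.cons hc c, ?_, fun x => ?_⟩
  · refine (Walk.cons_isCycle_iff _ _).2 ⟨hpath, fun he => ?_⟩
    rw [Sym2.eq_swap] at he
    have h1 := hpath.length_eq_one_of_mem_edges he
    have h2 := congrArg List.length hs
    rw [Walk.length_support, List.length_map, List.length_range] at h2
    omega
  · rw [Walk.support_cons, List.mem_cons, hs]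
    simp only [List.mem_map, List.mem_range, or_iff_right_iff_imp]
    rintro rfl
    exact ⟨k - 1, by omega, rfl⟩

theorem SimpleGraph.Walk.IsCycle.isHamiltonianCycle_of_mem [DecidableEq V] {v : V}
    {c : G.Walk v v} (hc : c.IsCycle) (h : ∀ x, x ∈ c.support) : c.IsHamiltonianCycle := by
  refine ⟨hc, hc.isPath_tail.isHamiltonian_of_mem fun x => ?_⟩
  have hx := h x
  rw [← Walk.cons_support_tail hc.not_nil, List.mem_cons] at hx
  rcases hx with rfl | hx
  · exact Walk.end_mem_support _
  · exact hx

theorem SimpleGraph.Walk.IsCycle.length_le_card [Fintype V] {v : V}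
    {c : G.Walk v v} (hc : c.IsCycle) : c.length ≤ Fintype.card V := by
  have := hc.support_nodup.length_le_card
  rwa [List.length_tail, Walk.length_support, Nat.add_sub_cancel] at this

/-- A cycle through an independent set is at least twice as long as the set is large. -/
theorem SimpleGraph.Walk.IsCycle.two_mul_card_le_length {v : V} {c : G.Walk v v}
    (hc : c.IsCycle) {S : Finset V} (hS : ∀ x ∈ S, ∀ y ∈ S, ¬G.Adj x y)
    (hmem : ∀ x ∈ S, x ∈ c.support) : 2 * S.card ≤ c.length := by
  have hpos : 0 < c.length := by
    have := hc.three_le_length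
    omega
  have hidx : ∀ x ∈ S, ∃ i < c.length, c.getVert i = x := by
    intro x hx
    obtain ⟨i, hi, hle⟩ := Walk.mem_support_iff_exists_getVert.1 (hmem x hx)
    rcases hle.lt_or_eq with hlt | rfl
    · exact ⟨i, hlt, hi⟩
    · exact ⟨0, hpos, by rw [← hi]; simp⟩
  have h₁ : S.card ≤ ((range c.length).filter fun i => c.getVert i ∈ S).card := by
    refine (card_le_card (t := ((range c.length).filter
      fun i => c.getVert i ∈ S).image c.getVert) fun x hx => ?_).trans card_image_le
    obtain ⟨i, hi, rfl⟩ := hidx x hx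
    exact mem_image.2 ⟨i, by simp [hi, hx], rfl⟩
  have h₂ : S.card ≤ ((range c.length).filter fun i => c.getVert (i + 1) ∈ S).card := by
    refine (card_le_card (t := ((range c.length).filter
      fun i => c.getVert (i + 1) ∈ S).image fun i => c.getVert (i + 1)) fun x hx => ?_).trans
      card_image_le
    obtain ⟨i, hi, rfl⟩ := hidx x hx
    rcases Nat.eq_zero_or_pos i with rfl | hi0
    · have h0 : c.getVert 0 = c.getVert (c.length - 1 + 1) := by
        rw [Nat.sub_add_cancel hpos]
        simp
      exact mem_image.2 ⟨c.length - 1,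
        mem_filter.2 ⟨mem_range.2 (by omega), by rwa [← h0]⟩, h0.symm⟩
    · exact mem_image.2 ⟨i - 1, by simp [Nat.sub_add_cancel hi0, hx]; omega,
        by rw [Nat.sub_add_cancel hi0]⟩
  have hdis : Disjoint ((range c.length).filter fun i => c.getVert i ∈ S)
      ((range c.length).filter fun i => c.getVert (i + 1) ∈ S) := by
    rw [disjoint_filter]
    exact fun i hi h h' => hS _ h _ h' (c.adj_getVert_succ (mem_range.1 hi))
  have := card_le_card (union_subset (filter_subset _ _) (filter_subset _ _) :
    ((range c.length).filter fun i => c.getVert i ∈ S) ∪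
      ((range c.length).filter fun i => c.getVert (i + 1) ∈ S) ⊆ range c.length)
  rw [card_union_of_disjoint hdis, card_range] at this
  omega

theorem exists_last_mem_of_le (P : ℕ → Prop) {s e : ℕ} (hse : s ≤ e) (hs : P s) (he : ¬P e) :
    ∃ i, s ≤ i ∧ i < e ∧ P i ∧ ¬P (i + 1) := by
  induction e, hse using Nat.le_induction with
  | base => exact absurd hs he
  | succ e hse ih =>
    by_cases hPe : P e
    · exact ⟨e, hse, by omega, hPe, he⟩
    · obtain ⟨i, h₁, h₂, h₃⟩ := ih hPe
      exact ⟨i, h₁, by omega, h₃⟩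

end Walks

/-- The vertices `w` and `z` separate the nonempty vertex sets `A` and `B`, which together contain
all other vertices. -/
structure IsSeparation {V : Type*} (G : SimpleGraph V) (w z : V) (A B : Finset V) : Prop where
  ne : w ≠ z
  left_nonempty : A.Nonempty
  right_nonempty : B.Nonempty
  disjoint : Disjoint A B
  w_notMem_left : w ∉ A
  w_notMem_right : w ∉ B
  z_notMem_left : z ∉ A
  z_notMem_right : z ∉ B
  cover : ∀ x, x = w ∨ x = z ∨ x ∈ A ∨ x ∈ B
  not_adj : ∀ a ∈ A, ∀ b ∈ B, ¬G.Adj a b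

namespace IsSeparation

variable {V : Type*} {G : SimpleGraph V} {w z : V} {A B : Finset V}

theorem symm (h : IsSeparation G w z A B) : IsSeparation G w z B A where
  ne := h.ne
  left_nonempty := h.right_nonempty
  right_nonempty := h.left_nonempty
  disjoint := h.disjoint.symm
  w_notMem_left := h.w_notMem_right
  w_notMem_right := h.w_notMem_left
  z_notMem_left := h.z_notMem_right
  z_notMem_right := h.z_notMem_left
  cover x := by
    have := h.cover x
    tauto
  not_adj a ha b hb hab := h.not_adj b hb a ha hab.symm

theorem card_add_card_add_two [Fintype V] (h : IsSeparation G w z A B) :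
    A.card + B.card + 2 = Fintype.card V := by
  have hu : (univ : Finset V) = insert w (insert z (A ∪ B)) := by
    ext x
    simpa using h.cover x
  rw [← card_univ, hu, card_insert_of_notMem, card_insert_of_notMem,
    card_union_of_disjoint h.disjoint]
  · simp [h.z_notMem_left, h.z_notMem_right]
  · simp [h.ne, h.w_notMem_left, h.w_notMem_right]

theorem neighborFinset_subset [Fintype V] (h : IsSeparation G w z A B) {u : V} (hu : u ∈ A) :
    G.neighborFinset u ⊆ (insert w (insert z A)).erase u := by
  intro x hx
  rw [mem_neighborFinset] at hx
  simp only [mem_erase, mem_insert]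
  refine ⟨hx.ne', ?_⟩
  rcases h.cover x with hc | hc | hc | hc
  · exact Or.inl hc
  · exact Or.inr (Or.inl hc)
  · exact Or.inr (Or.inr hc)
  · exact absurd hx (h.not_adj u hu x hc)

theorem card_erase_insert (h : IsSeparation G w z A B) {u : V} (hu : u ∈ A) :
    ((insert w (insert z A)).erase u).card = A.card + 1 := by
  rw [card_erase_of_mem (by simp [hu]), card_insert_of_notMem (by simp [h.ne, h.w_notMem_left]),
    card_insert_of_notMem h.z_notMem_left]
  rfl

theorem degree_le [Fintype V] (h : IsSeparation G w z A B) {u : V} (hu : u ∈ A) :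
    G.degree u ≤ A.card + 1 := by
  rw [← h.card_erase_insert hu, ← G.card_neighborFinset_eq_degree]
  exact card_le_card (h.neighborFinset_subset hu)

/-- Under Ore's condition the sides of a separation are completely joined to everything else. -/
theorem adj [Fintype V] (hG : IsOTG G) (h : IsSeparation G w z A B) {u v : V} (hu : u ∈ A)
    (hv : v ∉ B) (huv : v ≠ u) : G.Adj u v := by
  obtain ⟨b, hb⟩ := h.right_nonempty
  have hub : u ≠ b := fun he => Finset.disjoint_left.1 h.disjoint hu (he ▸ hb)
  have h₁ := hG u b hub (h.not_adj u hu b hb)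
  have h₂ := h.symm.degree_le hb
  have h₃ := h.card_add_card_add_two
  have heq := eq_of_subset_of_card_le (h.neighborFinset_subset hu) (by
    rw [h.card_erase_insert hu, G.card_neighborFinset_eq_degree]
    omega)
  rw [← mem_neighborFinset, heq]
  have := h.cover v
  simp only [mem_erase, mem_insert]
  tauto

/-- Under Ore's condition, the side of a separation contains no vertex of another separating pair,
apart from small graphs. -/
theorem not_isSeparation_of_mem_left [Fintype V] (hG : IsOTG G) (hn : 5 ≤ Fintype.card V)
    {w' z' : V} {A' B' : Finset V} (h : IsSeparation G w z A B) (hw' : w' ∈ A) :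
    ¬IsSeparation G w' z' A' B' := by
  intro h'
  have hBz : ∀ b ∈ B, b = z' := by
    intro b hb
    have hbw : w' ≠ b := fun he => Finset.disjoint_left.1 h.disjoint hw' (he ▸ hb)
    have hna := h.not_adj w' hw' b hb
    rcases h'.cover b with hc | hc | hc | hc
    · exact absurd hc.symm hbw
    · exact hc
    · exact absurd (h'.adj hG hc h'.w_notMem_right hbw).symm hna
    · exact absurd (h'.symm.adj hG hc h'.w_notMem_left hbw).symm hna
  have hB1 : B.card ≤ 1 := card_le_one.2 fun a ha b hb => (hBz a ha).trans (hBz b hb).symm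
  have hAcard := h.card_add_card_add_two
  obtain ⟨u, hu, huw⟩ := exists_mem_ne (show 1 < A.card by omega) w'
  obtain ⟨b, hb⟩ := h.right_nonempty
  have hub : u ≠ z' := by
    rintro rfl
    rw [hBz b hb] at hb
    exact Finset.disjoint_left.1 h.disjoint hu hb
  have key : ∀ A' B' : Finset V, IsSeparation G w' z' A' B' → u ∉ A' := by
    intro A' B' h' huA
    obtain ⟨x, hx⟩ := h'.right_nonempty
    refine h'.not_adj u huA x hx (h.adj hG hu (fun hxB => ?_) ?_)
    · exact h'.z_notMem_right (hBz x hxB ▸ hx)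
    · rintro rfl
      exact Finset.disjoint_left.1 h'.disjoint huA hx
  rcases h'.cover u with hc | hc | hc | hc
  · exact huw hc
  · exact hub hc
  · exact key A' B' h' hc
  · exact key B' A' h'.symm hc

theorem mem_support_of_isCycle (h : IsSeparation G w z A B) {v : V} {c : G.Walk v v}
    (hc : c.IsCycle) (hA : ∀ x ∈ A, x ∈ c.support) (hB : ∀ x ∈ B, x ∈ c.support) (x : V) :
    x ∈ c.support := by
  obtain ⟨a, ha⟩ := h.left_nonempty
  obtain ⟨b, hb⟩ := h.right_nonempty
  have hc' := hc.rotate (hA a ha)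
  set d := c.rotate a (hA a ha) with hd
  have hsup : ∀ y, y ∈ d.support ↔ y ∈ c.support := fun y => by simp [hd]
  obtain ⟨j, hj, hjle⟩ := Walk.mem_support_iff_exists_getVert.1 ((hsup b).2 (hB b hb))
  have hAB : ∀ y ∈ A, y ∉ B := fun y hy hy' => Finset.disjoint_left.1 h.disjoint hy hy'
  obtain ⟨i₁, -, hi₁, hPi₁, hNi₁⟩ := exists_last_mem_of_le (fun i => d.getVert i ∈ A)
    (Nat.zero_le j) (by simpa using ha) (fun hjA => hAB _ hjA (hj ▸ hb))
  obtain ⟨i₂, hji₂, hi₂, hPi₂, hNi₂⟩ := exists_last_mem_of_le (fun i => d.getVert i ∈ B)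
    hjle (by simpa [hj] using hb) (by simpa using hAB a ha)
  have hB₁ : d.getVert (i₁ + 1) ∉ B := fun hmem =>
    h.not_adj _ hPi₁ _ hmem (d.adj_getVert_succ (by omega))
  have hA₂ : d.getVert (i₂ + 1) ∉ A := fun hmem =>
    h.not_adj _ hmem _ hPi₂ (d.adj_getVert_succ (by omega)).symm
  have hne : d.getVert (i₁ + 1) ≠ d.getVert (i₂ + 1) := fun he => by
    have := hc'.getVert_injOn (by simp only [Set.mem_ofPred_eq]; omega)
      (by simp only [Set.mem_ofPred_eq]; omega) he
    have h' : i₁ + 1 = j := by omega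
    rw [h', hj] at hB₁
    exact hB₁ hb
  have h₁ := h.cover (d.getVert (i₁ + 1))
  have h₂ := h.cover (d.getVert (i₂ + 1))
  have hm₁ := (hsup _).1 (d.getVert_mem_support (i₁ + 1))
  have hm₂ := (hsup _).1 (d.getVert_mem_support (i₂ + 1))
  have hwz : w ∈ c.support ∧ z ∈ c.support := by
    rcases h₁ with h₁ | h₁ | h₁ | h₁ <;> rcases h₂ with h₂ | h₂ | h₂ | h₂ <;>
      first
      | exact absurd h₁ hNi₁
      | exact absurd h₁ hB₁
      | exact absurd h₂ hNi₂
      | exact absurd h₂ hA₂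
      | exact absurd (h₁.trans h₂.symm) hne
      | exact ⟨h₁ ▸ hm₁, h₂ ▸ hm₂⟩
      | exact ⟨h₂ ▸ hm₂, h₁ ▸ hm₁⟩
  rcases h.cover x with rfl | rfl | hx | hx
  · exact hwz.1
  · exact hwz.2
  · exact hA x hx
  · exact hB x hx

theorem isHForceSet [Fintype V] [DecidableEq V] (h : IsSeparation G w z A B) :
    IsHForceSet G (univ \ {w, z}) := by
  obtain ⟨a, ha⟩ := h.left_nonempty
  have hmem : ∀ x, x ∈ A ∨ x ∈ B → x ∈ (univ \ {w, z} : Finset V) := by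
    intro x hx
    simp only [mem_sdiff, mem_univ, true_and, mem_insert, mem_singleton]
    rintro (rfl | rfl)
    · exact hx.elim h.w_notMem_left h.w_notMem_right
    · exact hx.elim h.z_notMem_left h.z_notMem_right
  exact ⟨⟨a, hmem a (Or.inl ha)⟩, fun v c hc hX => hc.isHamiltonianCycle_of_mem
    (h.mem_support_of_isCycle hc (fun x hx => hX x (hmem x (Or.inl hx)))
      fun x hx => hX x (hmem x (Or.inr hx)))⟩

end IsSeparation

section HForce

variable {V : Type*} [Fintype V] [DecidableEq V] {G : SimpleGraph V}

theorem isHForceSet_univ [Nonempty V] : IsHForceSet G univ :=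
  ⟨univ_nonempty, fun _ _ hc hX => hc.isHamiltonianCycle_of_mem fun x => hX x (mem_univ x)⟩

theorem hForce_le_card {X : Finset V} (hX : IsHForceSet G X) : hForce G ≤ X.card :=
  Nat.sInf_le ⟨X, hX, rfl⟩

theorem exists_isHForceSet_card_eq [Nonempty V] (G : SimpleGraph V) :
    ∃ X, IsHForceSet G X ∧ X.card = hForce G :=
  Nat.sInf_mem (s := {k | ∃ X : Finset V, IsHForceSet G X ∧ X.card = k})
    ⟨_, univ, isHForceSet_univ, rfl⟩

theorem IsHForceSet.isMin {X : Finset V} (hX : IsHForceSet G X) (hle : X.card ≤ hForce G) :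
    IsMinHForceSet G X :=
  ⟨hX, fun _ hY => hle.trans (hForce_le_card hY)⟩

theorem degree_le_of_indep {S : Finset V} (hS : ∀ x ∈ S, ∀ y ∈ S, ¬G.Adj x y) {u : V}
    (hu : u ∈ S) : G.degree u ≤ Fintype.card V - S.card := by
  rw [← G.card_neighborFinset_eq_degree, ← card_compl]
  refine card_le_card fun x hx => ?_
  rw [mem_neighborFinset] at hx
  exact mem_compl.2 fun hxS => hS u hu x hxS hx

theorem IsOTG.two_mul_card_le (hG : IsOTG G) (hn : 2 ≤ Fintype.card V) {S : Finset V}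
    (hS : ∀ x ∈ S, ∀ y ∈ S, ¬G.Adj x y) : 2 * S.card ≤ Fintype.card V := by
  by_contra hlt
  obtain ⟨u, hu, v, hv, huv⟩ := one_lt_card.1 (show 1 < S.card by omega)
  have := hG u v huv (hS u hu v hv)
  have := degree_le_of_indep hS hu
  have := degree_le_of_indep hS hv
  omega

theorem isHForceSet_of_indep (hn : 1 ≤ Fintype.card V) {S : Finset V}
    (hS : ∀ x ∈ S, ∀ y ∈ S, ¬G.Adj x y) (hcard : Fintype.card V ≤ 2 * S.card) :
    IsHForceSet G S := by
  refine ⟨card_pos.1 (by omega), fun v c hc hX => ?_⟩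
  rw [Walk.isHamiltonianCycle_iff_isCycle_and_length_eq]
  exact ⟨hc, hc.length_le_card.antisymm (hcard.trans (hc.two_mul_card_le_length hS hX))⟩

/-- A vertex outside some H-force set yields a large independent set or a separating pair. -/
theorem IsHForceSet.exists_indep_or_isSeparation (hG : IsOTG G) (hn : 5 ≤ Fintype.card V)
    {X : Finset V} (hX : IsHForceSet G X) {w : V} (hw : w ∉ X) :
    (∃ S : Finset V, (∀ x ∈ S, ∀ y ∈ S, ¬G.Adj x y) ∧ Fintype.card V ≤ 2 * S.card) ∨
      ∃ z A B, IsSeparation G w z A B := by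
  let f : {v // v ≠ w} ↪ V := Function.Embedding.subtype _
  have hcard : Fintype.card {v // v ≠ w} = Fintype.card V - 1 := by
    rw [Fintype.card_subtype, filter_ne', card_erase_of_mem (mem_univ _), card_univ]
  have hdeg : ∀ u : {v // v ≠ w}, G.degree u ≤ (G.comap f).degree u + 1 := by
    intro u
    rw [← G.card_neighborFinset_eq_degree, ← (G.comap f).card_neighborFinset_eq_degree,
      ← card_map f]
    refine (card_le_card (t := insert w (((G.comap f).neighborFinset u).map f))
      fun x hx => ?_).trans (card_insert_le _ _)
    rw [mem_neighborFinset] at hx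
    by_cases hxw : x = w
    · simp [hxw]
    · refine mem_insert_of_mem (mem_map.2 ⟨⟨x, hxw⟩, ?_, rfl⟩)
      rw [mem_neighborFinset]
      exact hx
  have hd : ∀ u v : {v // v ≠ w}, u ≠ v → ¬(G.comap f).Adj u v →
      Fintype.card {v // v ≠ w} ≤ (G.comap f).degree u + (G.comap f).degree v + 1 := by
    intro u v huv hadj
    have h₁ := hG u v (fun h => huv (Subtype.ext h)) hadj
    have := hdeg u
    have := hdeg v
    omega
  rcases exists_cycle_or_indep_or_cut (G := G.comap f) (by omega) hd with
    ⟨q, hq, hc⟩ | ⟨S, hS, hSc⟩ | ⟨z, A, B, hA, hB, hAB, hzA, hzB, hcov, hnadj⟩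
  · exfalso
    have hq' : IsSeqPath G (fun i => (q i : V)) (Fintype.card {v // v ≠ w}) :=
      ⟨fun i hi j hj hij => hq.1 i hi j hj (Subtype.ext hij), hq.2⟩
    obtain ⟨c, hcyc, hsup⟩ := hq'.exists_cycle (by omega) hc
    have hham := hX.2 _ c hcyc fun x hx => by
      obtain ⟨i, hi, hix⟩ := hq.exists_eq ⟨x, fun h => hw (h ▸ hx)⟩
      exact (hsup x).2 ⟨i, hi, by rw [hix]⟩
    obtain ⟨i, -, hi⟩ := (hsup w).1 (hham.mem_support w)
    exact (q i).2 hi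
  · refine Or.inl ⟨S.map f, ?_, by rw [card_map]; omega⟩
    intro x hx y hy
    obtain ⟨x, hx', rfl⟩ := mem_map.1 hx
    obtain ⟨y, hy', rfl⟩ := mem_map.1 hy
    exact hS x hx' y hy'
  · refine Or.inr ⟨z, A.map f, B.map f, ?_⟩
    have hwf : ∀ T : Finset {v // v ≠ w}, w ∉ T.map f := by
      intro T hT
      obtain ⟨x, -, hx⟩ := mem_map.1 hT
      exact x.2 hx
    refine ⟨z.2.symm, hA.map, hB.map, (disjoint_map f).2 hAB, hwf A, hwf B, ?_, ?_,
      fun x => ?_, ?_⟩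
    · exact fun h => hzA ((mem_map' f).1 h)
    · exact fun h => hzB ((mem_map' f).1 h)
    · by_cases hxw : x = w
      · exact Or.inl hxw
      · rcases hcov ⟨x, hxw⟩ with h | h | h
        · exact Or.inr (Or.inl (congrArg Subtype.val h))
        · exact Or.inr (Or.inr (Or.inl (mem_map.2 ⟨_, h, rfl⟩)))
        · exact Or.inr (Or.inr (Or.inr (mem_map.2 ⟨_, h, rfl⟩)))
    · intro a ha b hb
      obtain ⟨a, ha', rfl⟩ := mem_map.1 ha
      obtain ⟨b, hb', rfl⟩ := mem_map.1 hb
      exact hnadj a ha' b hb'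

end HForce

section WeakClosure

variable {V : Type*} [Fintype V] {G H : SimpleGraph V}

theorem WeakStep.adj {x y : V} (h : WeakStep G H) (hxy : H.Adj x y) :
    G.Adj x y ∨ Fintype.card V + 1 ≤ G.degree x + G.degree y := by
  obtain ⟨u, v, -, -, hd, rfl⟩ := h
  rw [sup_adj, edge_adj] at hxy
  rcases hxy with hxy | ⟨⟨rfl, rfl⟩ | ⟨rfl, rfl⟩, -⟩
  · exact Or.inl hxy
  · exact Or.inr hd
  · exact Or.inr (by omega)

theorem le_of_weakStep (h : Relation.ReflTransGen WeakStep G H) : G ≤ H := by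
  induction h with
  | refl => exact le_rfl
  | tail _ hs ih =>
    obtain ⟨u, v, -, -, -, rfl⟩ := hs
    exact ih.trans le_sup_left

theorem indep_of_weakStep (h : Relation.ReflTransGen WeakStep G H) {S : Finset V}
    (hS : ∀ x ∈ S, ∀ y ∈ S, ¬G.Adj x y) (hcard : Fintype.card V ≤ 2 * S.card) :
    ∀ x ∈ S, ∀ y ∈ S, ¬H.Adj x y := by
  induction h with
  | refl => exact hS
  | tail _ hs ih =>
    intro x hx y hy hxy
    rcases hs.adj hxy with hxy | hd
    · exact ih x hx y hy hxy
    · have := degree_le_of_indep ih hx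
      have := degree_le_of_indep ih hy
      have := card_le_univ S
      omega

theorem IsSeparation.of_weakStep (h : Relation.ReflTransGen WeakStep G H) {w z : V}
    {A B : Finset V} (hG : IsSeparation G w z A B) : IsSeparation H w z A B := by
  induction h with
  | refl => exact hG
  | tail _ hs ih =>
    refine { hG with not_adj := fun a ha b hb hab => ?_ }
    rcases hs.adj hab with hab | hd
    · exact ih.not_adj a ha b hb hab
    · have := ih.degree_le ha
      have := ih.symm.degree_le hb
      have := ih.card_add_card_add_two
      omega

theorem IsSeparation.mem_pair_of_degree_eq {w z : V} {A B : Finset V}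
    (h : IsSeparation G w z A B) {x : V} (hx : G.degree x = Fintype.card V - 1) :
    x = w ∨ x = z := by
  have key : ∀ A B : Finset V, IsSeparation G w z A B → x ∉ A := by
    intro A B h hxA
    have := h.degree_le hxA
    have := h.card_add_card_add_two
    have := h.right_nonempty.card_pos
    omega
  rcases h.cover x with hc | hc | hc | hc
  · exact Or.inl hc
  · exact Or.inr hc
  · exact absurd hc (key A B h)
  · exact absurd hc (key B A h.symm)

end WeakClosure

/-- For an OTG `G` with `n ≥ 5` vertices and weak closure `Gw`: if `h(G) = n - 2` then
`V(G) \ {x, y}` is a minimum H-force set, where `x, y` are the vertices of degree `n - 1`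
in `Gw`; if `h(G) = n / 2` then every largest independent set of `Gw` is a minimum H-force
set; if `h(G) = n` then `V(G)` is the only H-force set. -/
theorem stmt_9 {V : Type*} [Fintype V] [DecidableEq V] (G Gw : SimpleGraph V)
    (hn : 5 ≤ Fintype.card V) (hOTG : IsOTG G) (hw : IsWeakClosure G Gw) :
    (hForce G = Fintype.card V - 2 →
      ∀ x y : V, x ≠ y → Gw.degree x = Fintype.card V - 1 →
        Gw.degree y = Fintype.card V - 1 →
        IsMinHForceSet G (Finset.univ \ {x, y})) ∧
    (2 * hForce G = Fintype.card V →
      ∀ S : Finset V, (∀ x ∈ S, ∀ y ∈ S, ¬Gw.Adj x y) →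
        (∀ T : Finset V, (∀ x ∈ T, ∀ y ∈ T, ¬Gw.Adj x y) → T.card ≤ S.card) →
        IsMinHForceSet G S) ∧
    (hForce G = Fintype.card V →
      ∀ X : Finset V, IsHForceSet G X ↔ X = Finset.univ) := by
  have : Nonempty V := Fintype.card_pos_iff.1 (by omega)
  obtain ⟨X, hX, hXcard⟩ := exists_isHForceSet_card_eq G
  refine ⟨fun hh x y hxy hx hy => ?_, fun hh S hS hmax => ?_, fun hh Y => ⟨fun hY => ?_, ?_⟩⟩
  · obtain ⟨w, hwX⟩ : ∃ w, w ∉ X := by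
      by_contra! hall
      have := card_le_card fun v (_ : v ∈ univ) => hall v
      rw [card_univ] at this
      omega
    rcases hX.exists_indep_or_isSeparation hOTG hn hwX with ⟨S, hS, hcard⟩ | ⟨z, A, B, hsep⟩
    · have := hForce_le_card (isHForceSet_of_indep (by omega) hS hcard)
      have := hOTG.two_mul_card_le (by omega) hS
      omega
    · have hset : ({x, y} : Finset V) = {w, z} := by
        have hsep' := hsep.of_weakStep hw.1
        rcases hsep'.mem_pair_of_degree_eq hx with rfl | rfl <;>
          rcases hsep'.mem_pair_of_degree_eq hy with rfl | rfl
        · exact absurd rfl hxy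
        · rfl
        · exact pair_comm _ _
        · exact absurd rfl hxy
      refine IsHForceSet.isMin (hset ▸ hsep.isHForceSet) ?_
      rw [card_sdiff_of_subset (subset_univ _), card_pair hxy, card_univ, hh]
  · have hbig : ∃ T : Finset V, (∀ x ∈ T, ∀ y ∈ T, ¬G.Adj x y) ∧
        Fintype.card V ≤ 2 * T.card := by
      by_contra hno
      have hsep : ∀ w, w ∉ X → ∃ z A B, IsSeparation G w z A B := fun w hw =>
        (hX.exists_indep_or_isSeparation hOTG hn hw).resolve_left hno
      obtain ⟨w, hwX⟩ : ∃ w, w ∉ X := by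
        by_contra! hall
        have := card_le_card fun v (_ : v ∈ univ) => hall v
        rw [card_univ] at this
        omega
      obtain ⟨z, A, B, h⟩ := hsep w hwX
      obtain ⟨w', hw'⟩ : ∃ w', w' ∉ insert w (insert z X) := by
        by_contra! hall
        have := card_insert_le w (insert z X)
        have := card_insert_le z X
        have := card_le_card fun v (_ : v ∈ univ) => hall v
        rw [card_univ] at this
        omega
      simp only [mem_insert, not_or] at hw'
      obtain ⟨z', A', B', h'⟩ := hsep w' hw'.2.2
      rcases h.cover w' with hc | hc | hc | hc
      · exact hw'.1 hc
      · exact hw'.2.1 hc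
      · exact h.not_isSeparation_of_mem_left hOTG hn hc h'
      · exact h.symm.not_isSeparation_of_mem_left hOTG hn hc h'
    obtain ⟨T, hT, hTcard⟩ := hbig
    have hTS := hmax T (indep_of_weakStep hw.1 hT hTcard)
    have hSG : ∀ x ∈ S, ∀ y ∈ S, ¬G.Adj x y := fun x hx y hy hxy =>
      hS x hx y hy (le_of_weakStep hw.1 hxy)
    have := hOTG.two_mul_card_le (by omega) hSG
    exact (isHForceSet_of_indep (by omega) hSG (by omega)).isMin (by omega)
  · rw [← card_eq_iff_eq_univ]
    exact (card_le_univ Y).antisymm (hh ▸ hForce_le_card hY)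
  · rintro rfl
    exact isHForceSet_univ
end

section
/- Let G_w be the weak closure of some OTG with n ≥ 5 vertices. Then h(G_w) = n − 2 if and only if G_w is isomorphic to K_2 ∨ (K_m + K_{n−m−2}) for some integer m with 1 ≤ m < n/2. -/
open Finset SimpleGraph
open scoped Classical

/-- The join `G ∨ H` of two graphs on disjoint vertex sets: their disjoint union together
with all edges between the two sides. -/
def graphJoin {α β : Type*} (G : SimpleGraph α) (H : SimpleGraph β) : SimpleGraph (α ⊕ β) :=
  (G ⊕g H) ⊔ completeBipartiteGraph α β

/-- The first `N` values of `p` are the consecutive vertices of a path of `G`. -/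
def IsPathSeq {V : Type*} (G : SimpleGraph V) (N : ℕ) (p : ℕ → V) : Prop :=
  (∀ i j, i < N → j < N → p i = p j → i = j) ∧ ∀ i, i + 1 < N → G.Adj (p i) (p (i + 1))

/-- The first `N` values of `p` are the consecutive vertices of a cycle of `G`. -/
def IsCycleSeq {V : Type*} (G : SimpleGraph V) (N : ℕ) (p : ℕ → V) : Prop :=
  3 ≤ N ∧ IsPathSeq G N p ∧ G.Adj (p (N - 1)) (p 0)

section Sequences

variable {V : Type*} {G : SimpleGraph V} {N : ℕ} {p : ℕ → V}

lemma IsPathSeq.adj_of_eq_succ (hp : IsPathSeq G N p) {i j : ℕ} (hi : i < N) (hj : j < N)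
    (h : j = i + 1 ∨ i = j + 1) : G.Adj (p i) (p j) := by
  rcases h with rfl | rfl
  · exact hp.2 _ hj
  · exact (hp.2 _ hi).symm

/-- Reordering the vertices of a path sequence along an injective map of indices. -/
lemma IsPathSeq.reindex (hp : IsPathSeq G N p) {M : ℕ} (f : ℕ → ℕ) (hf : ∀ i, i < M → f i < N)
    (hinj : ∀ i j, i < M → j < M → f i = f j → i = j)
    (hadj : ∀ i, i + 1 < M → f (i + 1) = f i + 1 ∨ f i = f (i + 1) + 1 ∨
      G.Adj (p (f i)) (p (f (i + 1)))) :
    IsPathSeq G M (fun i => p (f i)) := by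
  refine ⟨fun i j hi hj h => hinj i j hi hj (hp.1 _ _ (hf i hi) (hf j hj) h), fun i hi => ?_⟩
  have h1 := hf i (by lia)
  have h2 := hf (i + 1) hi
  rcases hadj i hi with h | h | h
  · exact hp.adj_of_eq_succ h1 h2 (.inl h)
  · exact hp.adj_of_eq_succ h1 h2 (.inr h)
  · exact h

/-- Rotation of a cycle sequence. -/
lemma IsCycleSeq.rotate (hp : IsCycleSeq G N p) {a : ℕ} (ha : a < N) :
    IsCycleSeq G N (fun i => p (if i + a < N then i + a else i + a - N)) := by
  obtain ⟨h3, hP, hc⟩ := hp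
  refine ⟨h3, hP.reindex _ (fun i hi => ?_) (fun i j hi hj h => ?_) (fun i hi => ?_), ?_⟩
  · split_ifs <;> lia
  · split_ifs at h <;> lia
  · by_cases h : i + a + 1 = N
    · right; right
      rw [if_pos (by lia), if_neg (by lia)]
      convert hc using 2 <;> lia
    · left; split_ifs <;> lia
  · by_cases h : a = 0
    · subst h
      simp only [add_zero, show N - 1 < N by lia, show 0 < N by lia, if_true]
      exact hc
    · dsimp only
      rw [if_neg (by lia), if_pos (by lia)]
      exact hP.adj_of_eq_succ (by lia) (by lia) (by lia)

/-- A cycle sequence can be rotated so as to start at a prescribed position. -/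
lemma IsCycleSeq.exists_rotate (hp : IsCycleSeq G N p) {a : ℕ} (ha : a < N) :
    ∃ q, IsCycleSeq G N q ∧ q 0 = p a ∧ ∀ i, i < N → ∃ j, j < N ∧ q j = p i := by
  refine ⟨_, hp.rotate ha, ?_, fun i hi => ?_⟩
  · simp [ha]
  · by_cases h : a ≤ i
    · exact ⟨i - a, by lia, by rw [if_pos (by lia)]; congr 1; lia⟩
    · exact ⟨i + N - a, by lia, by rw [if_neg (by lia)]; congr 1; lia⟩

/-- Appending a new vertex at the end of a path sequence. -/
lemma IsPathSeq.snoc (hp : IsPathSeq G N p) {s : V} (hs : ∀ i, i < N → p i ≠ s)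
    (h : 1 ≤ N → G.Adj (p (N - 1)) s) :
    IsPathSeq G (N + 1) (fun i => if i < N then p i else s) := by
  refine ⟨fun i j hi hj hij => ?_, fun i hi => ?_⟩
  · dsimp only at hij
    split_ifs at hij with h1 h2 h2
    · exact hp.1 _ _ h1 h2 hij
    · exact absurd hij (hs _ h1)
    · exact absurd hij.symm (hs _ h2)
    · lia
  · dsimp only
    rw [if_pos (by lia)]
    split_ifs with h1
    · exact hp.2 _ h1
    · convert h (by lia) using 2; lia

/-- If the first vertex of a path is adjacent to a vertex whose predecessor is adjacent to the
last vertex, the vertices of the path lie on a cycle. -/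
lemma IsPathSeq.isCycleSeq_of_crossing (hp : IsPathSeq G N p) (h3 : 3 ≤ N) {i : ℕ}
    (hi : i + 1 < N) (h0 : G.Adj (p 0) (p (i + 1))) (h1 : G.Adj (p (N - 1)) (p i)) :
    IsCycleSeq G N (fun j => p (if j ≤ i then j else N + i - j)) := by
  refine ⟨h3, hp.reindex _ (fun j hj => ?_) (fun j k hj hk h => ?_) (fun j hj => ?_), ?_⟩
  · split_ifs <;> lia
  · split_ifs at h <;> lia
  · by_cases h : j = i
    · right; right
      subst h
      rw [if_pos (by lia), if_neg (by lia)]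
      convert h1.symm using 2; lia
    · split_ifs <;> lia
  · dsimp only
    rw [if_neg (by lia), if_pos (by lia)]
    convert h0.symm using 2; lia

/-- A double crossing of a path also yields a cycle on the vertices of the path. -/
lemma IsPathSeq.isCycleSeq_of_chord (hp : IsPathSeq G N p) (h3 : 3 ≤ N) {j l : ℕ}
    (hjl : j + 2 ≤ l) (hl : l < N) (h : G.Adj (p j) (p l))
    (h0 : G.Adj (p 0) (p (j + 1))) (h1 : G.Adj (p (N - 1)) (p (l - 1))) :
    IsCycleSeq G N
      (fun i => p (if i ≤ j then i else if i ≤ j + (N - l) then l + (i - j - 1)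
        else l + j + (N - l) - i)) := by
  refine ⟨h3, hp.reindex _ (fun i hi => ?_) (fun i k hi hk h => ?_) (fun i hi => ?_), ?_⟩
  · split_ifs <;> lia
  · split_ifs at h <;> lia
  · by_cases h2 : i = j
    · right; right
      subst h2
      rw [if_pos (by lia), if_neg (by lia), if_pos (by lia)]
      convert h using 2; lia
    · by_cases h4 : i = j + (N - l)
      · right; right
        rw [if_neg (by lia), if_pos (by lia), if_neg (by lia), if_neg (by lia)]
        convert h1 using 2 <;> lia
      · split_ifs <;> lia
  · dsimp only
    rw [if_neg (by lia), if_neg (by lia), if_pos (by lia)]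
    convert h0.symm using 2; lia

lemma IsPathSeq.exists_walk (hp : IsPathSeq G N p) (k : ℕ) (hk : k < N) :
    ∃ w : G.Walk (p 0) (p k), w.support = (List.range (k + 1)).map p := by
  induction k with
  | zero => exact ⟨.nil, by simp⟩
  | succ k ih =>
    obtain ⟨w, hw⟩ := ih (by lia)
    refine ⟨w.concat (hp.2 k hk), ?_⟩
    rw [Walk.support_concat, hw, List.range_succ (n := k + 1)]
    simp

/-- A cycle sequence gives rise to a cycle of the graph. -/
lemma IsCycleSeq.exists_isCycle (hp : IsCycleSeq G N p) :
    ∃ (v : V) (c : G.Walk v v), c.IsCycle ∧ c.length = N ∧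
      ∀ x, x ∈ c.support ↔ ∃ i, i < N ∧ p i = x := by
  obtain ⟨h3, hP, hc⟩ := hp
  obtain ⟨w, hw⟩ := hP.exists_walk (N - 1) (by lia)
  rw [show N - 1 + 1 = N by lia] at hw
  have hl : w.length + 1 = N := by rw [← Walk.length_support, hw]; simp
  refine ⟨_, Walk.cons hc w, ?_, by simpa using hl, fun x => ?_⟩
  · rw [Walk.isCycle_iff_isPath_tail_and_le_length]
    refine ⟨?_, by simp; lia⟩
    have : w.IsPath := by
      rw [Walk.isPath_def, hw]
      refine List.Nodup.map_on (fun i hi j hj h => ?_) List.nodup_range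
      exact hP.1 i j (by simpa using hi) (by simpa using hj) h
    simpa using this
  · rw [Walk.support_cons, hw]
    simp only [List.mem_cons, List.mem_map, List.mem_range]
    refine ⟨?_, .inr⟩
    rintro (rfl | h)
    · exact ⟨N - 1, by lia, rfl⟩
    · exact h

/-- A cycle of the graph gives rise to a cycle sequence. -/
lemma isCycleSeq_of_isCycle {v : V} {c : G.Walk v v} (hc : c.IsCycle) :
    IsCycleSeq G c.length c.getVert ∧ ∀ x ∈ c.support, ∃ i, i < c.length ∧ c.getVert i = x := by
  have h3 := hc.three_le_length
  refine ⟨⟨h3, ⟨fun i j hi hj h => ?_, fun i hi => c.adj_getVert_succ (by lia)⟩, ?_⟩,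
    fun x hx => ?_⟩
  · exact hc.getVert_injOn' (by simp; lia) (by simp; lia) h
  · have := c.adj_getVert_succ (i := c.length - 1) (by lia)
    rw [show c.length - 1 + 1 = c.length by lia] at this
    simpa using this
  · obtain ⟨i, hi, hle⟩ := Walk.mem_support_iff_exists_getVert.1 hx
    rcases hle.lt_or_eq with h | h
    · exact ⟨i, h, hi⟩
    · subst h
      exact ⟨0, by lia, by simpa using hi⟩

end Sequences

section Ore

lemma degree_le_card_of_forall {V : Type*} [Fintype V] {G : SimpleGraph V} (x : V)
    (S : Finset V) (h : ∀ v, G.Adj x v → v ∈ S) : G.degree x ≤ #S := by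
  rw [← G.card_neighborFinset_eq_degree]
  exact card_le_card fun v hv => h v (by simpa using hv)

variable {V : Type*} [Fintype V] [DecidableEq V] {G : SimpleGraph V}

/-- The degree of `x` is at most the number of neighbours in a sequence covering all neighbours
outside a set `S`, plus the cardinality of `S`. -/
lemma degree_le_card_add_count (x : V) (S : Finset V) (M : ℕ) (q : ℕ → V)
    (h : ∀ v, G.Adj x v → v ∈ S ∨ ∃ i, i < M ∧ q i = v) :
    G.degree x ≤ #S + #{i ∈ range M | G.Adj x (q i)} := by
  refine (degree_le_card_of_forall x (S ∪ image q {i ∈ range M | G.Adj x (q i)})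
    fun v hv => ?_).trans ((card_union_le _ _).trans (by gcongr; exact card_image_le))
  rcases h v hv with h | ⟨i, hi, rfl⟩
  · exact mem_union_left _ h
  · exact mem_union_right _ (mem_image.2 ⟨i, by simp [hi, hv], rfl⟩)

/-- Either a crossing exists, or the end vertices of the path have complementary adjacencies. -/
lemma exists_crossing_or_forall {N : ℕ} {p : ℕ → V} (hN : 1 ≤ N) (S : Finset V)
    (hx : ∀ v, G.Adj (p 0) v → v ∈ S ∨ ∃ i, i < N ∧ p i = v)
    (hy : ∀ v, G.Adj (p (N - 1)) v → v ∈ S ∨ ∃ i, i < N ∧ p i = v)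
    (hd : N - 1 + 2 * #S ≤ G.degree (p 0) + G.degree (p (N - 1))) :
    (∃ i, i + 1 < N ∧ G.Adj (p 0) (p (i + 1)) ∧ G.Adj (p (N - 1)) (p i)) ∨
      (∀ i, i + 1 < N → G.Adj (p 0) (p (i + 1)) ∨ G.Adj (p (N - 1)) (p i)) ∧
        G.degree (p 0) + G.degree (p (N - 1)) = N - 1 + 2 * #S := by
  by_cases hex : ∃ i, i + 1 < N ∧ G.Adj (p 0) (p (i + 1)) ∧ G.Adj (p (N - 1)) (p i)
  · exact .inl hex
  right
  push Not at hex
  have h1 := degree_le_card_add_count (p 0) S (N - 1) (fun i => p (i + 1)) fun v hv => by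
    refine (hx v hv).imp_right ?_
    rintro ⟨i, hi, rfl⟩
    have : i ≠ 0 := by rintro rfl; exact hv.ne rfl
    exact ⟨i - 1, by lia, by congr 1; lia⟩
  have h2 := degree_le_card_add_count (p (N - 1)) S (N - 1) p fun v hv => by
    refine (hy v hv).imp_right ?_
    rintro ⟨i, hi, rfl⟩
    have : i ≠ N - 1 := by rintro rfl; exact hv.ne rfl
    exact ⟨i, by lia, rfl⟩
  set A := {i ∈ range (N - 1) | G.Adj (p 0) (p (i + 1))} with hA
  set B := {i ∈ range (N - 1) | G.Adj (p (N - 1)) (p i)} with hB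
  have hdisj : Disjoint A B := by
    rw [Finset.disjoint_left]
    intro i hi hi'
    simp only [hA, hB, mem_filter, Finset.mem_range] at hi hi'
    exact hex i (by lia) hi.2 hi'.2
  have hsub : A ∪ B ⊆ range (N - 1) := union_subset (filter_subset _ _) (filter_subset _ _)
  have hle := card_le_card hsub
  rw [card_union_of_disjoint hdisj, card_range] at hle
  refine ⟨fun i hi => ?_, by lia⟩
  have heq : A ∪ B = range (N - 1) :=
    eq_of_subset_of_card_le hsub (by rw [card_union_of_disjoint hdisj, card_range]; lia)
  have : i ∈ A ∪ B := by rw [heq]; simp; lia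
  rcases mem_union.1 this with h | h
  · exact .inl (mem_filter.1 h).2
  · exact .inr (mem_filter.1 h).2

lemma IsPathSeq.le_card {N : ℕ} {p : ℕ → V} (hp : IsPathSeq G N p) : N ≤ Fintype.card V := by
  rw [← card_range N, ← card_image_of_injOn (f := p) (s := range N)]
  · exact card_le_univ _
  · intro i hi j hj h
    exact hp.1 i j (by simpa using hi) (by simpa using hj) h

lemma IsPathSeq.surj_of_eq_card {p : ℕ → V} (hp : IsPathSeq G (Fintype.card V) p) (v : V) :
    ∃ i, i < Fintype.card V ∧ p i = v := by
  have : image p (range (Fintype.card V)) = univ := by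
    rw [← card_eq_iff_eq_univ, card_image_of_injOn, card_range]
    intro i hi j hj h
    exact hp.1 i j (by simpa using hi) (by simpa using hj) h
  have hv := mem_univ v
  rw [← this] at hv
  simpa using hv

/-- **Ore's theorem**, in terms of cycle sequences. -/
lemma exists_isCycleSeq_of_ore (h3 : 3 ≤ Fintype.card V)
    (hO : ∀ u v : V, u ≠ v → ¬G.Adj u v → Fintype.card V ≤ G.degree u + G.degree v) :
    ∃ p, IsCycleSeq G (Fintype.card V) p := by
  obtain ⟨v0⟩ : Nonempty V := Fintype.card_pos_iff.1 (by lia)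
  let P : ℕ → Prop := fun k => ∃ p, IsPathSeq G k p
  have hP1 : P 1 := ⟨fun _ => v0, by intro i j; lia, by intro i; lia⟩
  set k := Nat.findGreatest P (Fintype.card V) with hk
  have hk1 : 1 ≤ k := Nat.le_findGreatest (by lia) hP1
  obtain ⟨p, hp⟩ : P k := Nat.findGreatest_spec (m := 1) (by lia) hP1
  have hmax : ∀ p, ¬IsPathSeq G (k + 1) p := fun p' hp' => by
    have := Nat.le_findGreatest (P := P) hp'.le_card ⟨p', hp'⟩
    lia
  have hkn : k ≤ Fintype.card V := hp.le_card
  have hrev : IsPathSeq G k (fun i => p (k - 1 - i)) :=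
    hp.reindex _ (by lia) (by lia) (by lia)
  have hin : ∀ q, IsPathSeq G k q → ∀ v, G.Adj (q (k - 1)) v → ∃ i, i < k ∧ q i = v := by
    intro q hq v hv
    by_contra! hcon
    exact hmax _ (hq.snoc hcon fun _ => hv)
  have hy := hin p hp
  have hx : ∀ v, G.Adj (p 0) v → ∃ i, i < k ∧ p i = v := by
    intro v hv
    obtain ⟨i, hi, h⟩ := hin _ hrev v (by simpa using hv)
    exact ⟨_, by lia, h⟩
  have hdeg : ∀ x, (∀ v, G.Adj x v → ∃ i, i < k ∧ p i = v) → (∃ i, i < k ∧ p i = x) →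
      G.degree x + 1 ≤ k := by
    intro x h ⟨i, hi, hix⟩
    have : G.degree x ≤ #(image p ((range k).erase i)) := by
      refine degree_le_card_of_forall x _ fun v hv => ?_
      obtain ⟨j, hj, rfl⟩ := h v hv
      refine mem_image_of_mem _ (mem_erase.2 ⟨?_, by simpa using hj⟩)
      rintro rfl
      exact hv.ne hix.symm
    have h' := this.trans card_image_le
    rw [card_erase_of_mem (by simpa using hi), card_range] at h'
    lia
  have hdx := hdeg _ hx ⟨0, by lia, rfl⟩
  -- a longest path closes up to a cycle
  have hcyc : ∃ c, IsCycleSeq G k c := by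
    by_cases hxy : G.Adj (p (k - 1)) (p 0)
    · by_cases hk3 : 3 ≤ k
      · exact ⟨p, hk3, hp, hxy⟩
      exfalso
      -- a path with at most two vertices is not longest
      by_cases hall : ∀ v, v ≠ p 0 → G.Adj (p 0) v
      · have : univ.erase (p 0) ⊆ G.neighborFinset (p 0) := fun v hv => by
          simpa using hall v (ne_of_mem_erase hv)
        have := card_le_card this
        rw [card_erase_of_mem (mem_univ _), card_univ, G.card_neighborFinset_eq_degree] at this
        lia
      · push Not at hall
        obtain ⟨v, hv, hna⟩ := hall
        have := hO _ _ hv.symm hna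
        have := G.degree_lt_card_verts v
        have hvd : G.degree v + 2 ≤ Fintype.card V := by
          have : G.degree v ≤ #((univ.erase v).erase (p 0)) :=
            degree_le_card_of_forall v _ fun w hw => by
              simp only [mem_erase, Finset.mem_univ, and_true]
              exact ⟨by rintro rfl; exact hna hw.symm, hw.ne'⟩
          rw [card_erase_of_mem (by simpa using hv.symm), card_erase_of_mem (mem_univ _),
            card_univ] at this
          lia
        lia
    · have hk0 : p 0 ≠ p (k - 1) := by
        intro h
        have hk' : k = 1 := by have := hp.1 0 (k - 1) (by lia) (by lia) h; lia
        have hd0 : G.degree (p 0) = 0 := by lia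
        obtain ⟨v, hv⟩ := Fintype.exists_ne_of_one_lt_card (by lia : 1 < Fintype.card V) (p 0)
        have hna : ¬G.Adj (p 0) v := fun ha => by
          obtain ⟨i, hi, h⟩ := hx v ha
          exact hv (by rw [← h]; congr 1; lia)
        have := hO _ _ hv.symm hna
        have := G.degree_lt_card_verts v
        lia
      have hdy := hdeg _ hy ⟨k - 1, by lia, rfl⟩
      have hOxy := hO _ _ hk0 fun h => hxy h.symm
      rcases exists_crossing_or_forall hk1 ∅ (fun v hv => .inr (hx v hv))
          (fun v hv => .inr (hy v hv)) (by simp; lia) with ⟨i, hi, h1, h2⟩ | ⟨-, h⟩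
      · exact ⟨_, hp.isCycleSeq_of_crossing (by lia) hi h1 h2⟩
      · simp at h; lia
  obtain ⟨c, hc⟩ := hcyc
  rcases hkn.lt_or_eq with hlt | heq
  · exfalso
    obtain ⟨z, hz⟩ : ∃ z, ∀ i, i < k → c i ≠ z := by
      by_contra! hcon
      have : (univ : Finset V) ⊆ image c (range k) := fun v _ => by
        obtain ⟨i, hi, h⟩ := hcon v
        exact mem_image.2 ⟨i, by simpa using hi, h⟩
      have := (card_le_card this).trans card_image_le
      rw [card_range, card_univ] at this
      lia
    by_cases hadj : ∃ i, i < k ∧ G.Adj z (c i)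
    · obtain ⟨i, hi, hza⟩ := hadj
      -- rotate so that the neighbour of `z` comes last
      have hlast : ∃ a, a < k ∧ (if k - 1 + a < k then k - 1 + a else k - 1 + a - k) = i := by
        by_cases h : i + 1 < k
        · exact ⟨i + 1, by lia, by rw [if_neg (by lia)]; lia⟩
        · exact ⟨0, by lia, by rw [if_pos (by lia)]; lia⟩
      obtain ⟨a, ha, hai⟩ := hlast
      refine hmax _ ((hc.rotate ha).2.1.snoc (s := z) (fun j hj => ?_) fun _ => ?_)
      · split_ifs
        · exact hz _ (by lia)
        · exact hz _ (by lia)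
      · rw [hai]; exact hza.symm
    · push Not at hadj
      have h0 := hz 0 (by have := hc.1; lia)
      have h1 : G.degree (c 0) + 1 ≤ k := by
        have : G.degree (c 0) ≤ #((image c (range k)).erase (c 0)) := by
          refine degree_le_card_of_forall _ _ fun v hv => ?_
          refine mem_erase.2 ⟨hv.ne', ?_⟩
          by_contra hcon
          have hc' : ∀ i, i < k → c i ≠ v := fun i hi h =>
            hcon (mem_image.2 ⟨i, by simpa using hi, h⟩)
          have hrot := (hc.rotate (a := 1) (by have := hc.1; lia))
          refine hmax _ (hrot.2.1.snoc (s := v) (fun j hj => ?_) fun _ => ?_)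
          · split_ifs
            · exact hc' _ (by lia)
            · exact hc' _ (by lia)
          · rw [if_neg (by lia)]
            convert hv using 2
            lia
        have hm : c 0 ∈ image c (range k) :=
          mem_image.2 ⟨0, by have := hc.1; simp; lia, rfl⟩
        rw [card_erase_of_mem hm] at this
        have := card_image_le (s := range k) (f := c)
        rw [card_range] at this
        have := card_pos.2 ⟨_, hm⟩
        lia
      have h2 : G.degree z + k + 1 ≤ Fintype.card V := by
        have hcard : #(image c (range k)) = k := by
          rw [card_image_of_injOn, card_range]
          intro i hi j hj h
          exact hc.2.1.1 i j (by simpa using hi) (by simpa using hj) h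
        have hz' : z ∉ image c (range k) := by
          simp only [mem_image, Finset.mem_range, not_exists, not_and]
          exact hz
        have : G.degree z ≤ #(insert z (image c (range k)))ᶜ := by
          refine degree_le_card_of_forall _ _ fun v hv => ?_
          simp only [mem_compl, mem_insert, mem_image, Finset.mem_range, not_or, not_exists,
            not_and]
          exact ⟨hv.ne', fun i hi h => hadj i hi (h ▸ hv)⟩
        rw [card_compl, card_insert_of_notMem hz', hcard] at this
        lia
      have := hO _ _ h0 fun h => hadj 0 (by have := hc.1; lia) h.symm
      lia
  · exact ⟨c, heq ▸ hc⟩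

end Ore

section Insertion

variable {V : Type*} {G : SimpleGraph V} {M : ℕ} {c : ℕ → V} {s : V}

/-- The path obtained by opening a cycle before the successor of `c j` and appending `s`. -/
lemma IsCycleSeq.isPathSeq_snoc (hc : IsCycleSeq G M c) (hs : ∀ i, i < M → c i ≠ s) {j a : ℕ}
    (hj : j < M) (ha : a = if j + 1 < M then j + 1 else 0) (h : G.Adj s (c j)) :
    IsPathSeq G (M + 1)
      (fun i => if i < M then c (if i + a < M then i + a else i + a - M) else s) := by
  have haM : a < M := by rw [ha]; split_ifs <;> lia
  refine (hc.rotate haM).2.1.snoc (fun i hi => ?_) fun _ => ?_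
  · split_ifs
    · exact hs _ (by lia)
    · exact hs _ (by lia)
  · convert h.symm using 2
    split_ifs at ha ⊢ <;> lia

/-- If a new vertex is adjacent to two consecutive vertices of a cycle, it can be inserted. -/
lemma IsCycleSeq.exists_insert_of_adj_succ (hc : IsCycleSeq G M c) (hs : ∀ i, i < M → c i ≠ s)
    {j a : ℕ} (hj : j < M) (ha : a = if j + 1 < M then j + 1 else 0) (h : G.Adj s (c j))
    (h' : G.Adj s (c a)) :
    ∃ q, IsCycleSeq G (M + 1) q ∧ ∀ i, i < M + 1 → q i = s ∨ ∃ k, k < M ∧ q i = c k := by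
  have h3 := hc.1
  have haM : a < M := by rw [ha]; split_ifs <;> lia
  refine ⟨_, ⟨by lia, hc.isPathSeq_snoc hs hj ha h, ?_⟩, fun i hi => ?_⟩
  · simpa [show 0 < M by lia, haM] using h'
  · by_cases h1 : i < M
    · rw [if_pos h1]
      exact .inr ⟨_, by split_ifs <;> lia, rfl⟩
    · rw [if_neg h1]; exact .inl rfl

/-- If a new vertex is adjacent to two vertices of a cycle with adjacent successors, it can be
inserted. -/
lemma IsCycleSeq.exists_insert_of_adj_succ_succ (hc : IsCycleSeq G M c)
    (hs : ∀ i, i < M → c i ≠ s) {j k a b : ℕ} (hj : j < M) (hk : k < M) (hjk : j ≠ k)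
    (ha : a = if j + 1 < M then j + 1 else 0) (hb : b = if k + 1 < M then k + 1 else 0)
    (hsj : G.Adj s (c j)) (hsk : G.Adj s (c k)) (hab : G.Adj (c a) (c b)) :
    ∃ q, IsCycleSeq G (M + 1) q ∧ ∀ i, i < M + 1 → q i = s ∨ ∃ k, k < M ∧ q i = c k := by
  have h3 := hc.1
  have haM : a < M := by rw [ha]; split_ifs <;> lia
  obtain ⟨k', hk'⟩ : ∃ k', k' = if a ≤ k then k - a else k + M - a := ⟨_, rfl⟩
  have hlt : k' + 1 < M := by split_ifs at ha hk' <;> lia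
  refine ⟨_, (hc.isPathSeq_snoc hs hj ha hsj).isCycleSeq_of_crossing (by lia) (i := k')
    (by lia) ?_ ?_, fun i hi => ?_⟩
  · rw [if_pos (by lia), if_pos (by lia), if_pos hlt]
    convert hab using 2
    · lia
    · split_ifs at hb hk' ⊢ <;> lia
  · rw [if_neg (by lia), if_pos (by lia)]
    convert hsk using 2
    split_ifs at hk' ⊢ <;> lia
  · generalize (if i ≤ k' then i else M + 1 + k' - i) = i'
    by_cases h1 : i' < M
    · rw [if_pos h1]
      exact .inr ⟨_, by split_ifs <;> lia, rfl⟩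
    · rw [if_neg h1]; exact .inl rfl

end Insertion

section Structure

variable {V : Type*} [Fintype V] [DecidableEq V] {G : SimpleGraph V}

/-- In a graph all of whose nonadjacent pairs have degree sum equal to the order, an independent
set with at least three elements, one of which has degree at most the size of the set, contains
exactly half of the vertices. -/
lemma two_mul_card_eq_of_independent
    (hO : ∀ u v : V, u ≠ v → ¬G.Adj u v → G.degree u + G.degree v = Fintype.card V)
    {I : Finset V} (hI : ∀ a ∈ I, ∀ b ∈ I, ¬G.Adj a b) (h3 : 3 ≤ #I) {s : V} (hs : s ∈ I)
    (hd : G.degree s ≤ #I) : 2 * #I = Fintype.card V := by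
  obtain ⟨t, ht, hts⟩ := exists_mem_ne (by lia : 1 < #I) s
  obtain ⟨u, hu, hus⟩ := exists_mem_ne
    (by rw [card_erase_of_mem hs]; lia : 1 < #(I.erase s)) t
  obtain ⟨hu', huI⟩ := mem_erase.1 hu
  have h1 := hO s t hts.symm (hI s hs t ht)
  have h2 := hO s u hu'.symm (hI s hs u huI)
  have h4 := hO t u hus.symm (hI t ht u huI)
  have h5 : G.degree s ≤ #Iᶜ := degree_le_card_of_forall _ _ fun v hv => by
    rw [mem_compl]; exact fun h => hI s hs v h hv
  rw [card_compl] at h5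
  have := card_le_univ I
  lia

/-- A cycle through all but two vertices `s`, `w`, that cannot be enlarged by `s`, yields a large
independent set. -/
lemma exists_independent_of_isCycleSeq {M : ℕ} {c : ℕ → V} {s w : V}
    (hO : ∀ u v : V, u ≠ v → ¬G.Adj u v → G.degree u + G.degree v = Fintype.card V)
    (hc : IsCycleSeq G M c) (hs : ∀ i, i < M → c i ≠ s)
    (hcov : ∀ v, v = w ∨ v = s ∨ ∃ i, i < M ∧ c i = v)
    (hno : ∀ q, IsCycleSeq G (M + 1) q →
      ¬∀ i, i < M + 1 → q i = s ∨ ∃ k, k < M ∧ q i = c k)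
    {j k : ℕ} (hj : j < M) (hk : k < M) (hjk : j ≠ k) (hsj : G.Adj s (c j))
    (hsk : G.Adj s (c k)) :
    ∃ I : Finset V, 3 ≤ #I ∧ 2 * #I = Fintype.card V ∧ ∀ a ∈ I, ∀ b ∈ I, ¬G.Adj a b := by
  obtain ⟨nxt, hnxt⟩ : ∃ f : ℕ → ℕ, ∀ i, f i = if i + 1 < M then i + 1 else 0 := ⟨_, fun _ => rfl⟩
  have hnxtM : ∀ i, i < M → nxt i < M := fun i hi => by rw [hnxt]; split_ifs <;> lia
  set S := {i ∈ range M | G.Adj s (c i)} with hS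
  have hmem : ∀ i, i ∈ S ↔ i < M ∧ G.Adj s (c i) := by simp [hS]
  set T := image (fun i => c (nxt i)) S with hT
  have hTcard : #T = #S := card_image_of_injOn fun a ha b hb h => by
    have ha' := ((hmem a).1 ha).1
    have hb' := ((hmem b).1 hb).1
    have := hc.2.1.1 _ _ (hnxtM a ha') (hnxtM b hb') h
    rw [hnxt, hnxt] at this
    split_ifs at this <;> lia
  have hsT : s ∉ T := by
    simp only [hT, mem_image, not_exists, not_and]
    exact fun i hi => hs _ (hnxtM i ((hmem i).1 hi).1)
  have hsN : ∀ i ∈ S, ¬G.Adj s (c (nxt i)) := fun i hi h => by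
    obtain ⟨h1, h2⟩ := (hmem i).1 hi
    obtain ⟨q, hq, hq'⟩ := hc.exists_insert_of_adj_succ hs h1 (hnxt i) h2 h
    exact hno q hq hq'
  have hind : ∀ a ∈ insert s T, ∀ b ∈ insert s T, ¬G.Adj a b := by
    intro a ha b hb h
    rcases mem_insert.1 ha with rfl | ha <;> rcases mem_insert.1 hb with rfl | hb
    · exact h.ne rfl
    · obtain ⟨i, hi, rfl⟩ := mem_image.1 hb
      exact hsN i hi h
    · obtain ⟨i, hi, rfl⟩ := mem_image.1 ha
      exact hsN i hi h.symm
    · obtain ⟨i, hi, rfl⟩ := mem_image.1 ha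
      obtain ⟨i', hi', rfl⟩ := mem_image.1 hb
      obtain ⟨h1, h2⟩ := (hmem i).1 hi
      obtain ⟨h1', h2'⟩ := (hmem i').1 hi'
      have hne : i ≠ i' := by rintro rfl; exact h.ne rfl
      obtain ⟨q, hq, hq'⟩ := hc.exists_insert_of_adj_succ_succ hs h1 h1' hne (hnxt i) (hnxt i')
        h2 h2' h
      exact hno q hq hq'
  have h2S : 2 ≤ #S := by
    rw [← card_pair hjk]
    refine card_le_card fun i hi => ?_
    rcases mem_insert.1 hi with rfl | hi
    · exact (hmem _).2 ⟨hj, hsj⟩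
    · rw [mem_singleton.1 hi]; exact (hmem _).2 ⟨hk, hsk⟩
  have hIcard : #(insert s T) = #S + 1 := by rw [card_insert_of_notMem hsT, hTcard]
  have hdeg := degree_le_card_add_count (G := G) s {w} M c fun v hv => by
    rcases hcov v with h | h | h
    · exact .inl (by simp [h])
    · exact absurd h.symm hv.ne
    · exact .inr h
  rw [card_singleton] at hdeg
  refine ⟨insert s T, by lia, ?_, hind⟩
  exact two_mul_card_eq_of_independent hO hind (by lia) (mem_insert_self _ _) (by lia)

/-- If all nonadjacent pairs have degree sum equal to the order, then for every vertex `w` either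
some cycle misses precisely `w`, or `w` belongs to a cut of size two, or half of the vertices are
independent. -/
lemma exists_cycle_avoiding_or_cut_or_independent (hn : 5 ≤ Fintype.card V)
    (hO : ∀ u v : V, u ≠ v → ¬G.Adj u v → G.degree u + G.degree v = Fintype.card V) (w : V) :
    (∃ q, IsCycleSeq G (Fintype.card V - 1) q ∧ ∀ i, i < Fintype.card V - 1 → q i ≠ w) ∨
    (∃ z, z ≠ w ∧ ∃ A B : Finset V, A.Nonempty ∧ B.Nonempty ∧ Disjoint A B ∧
      (∀ v, v ∈ A ∪ B ↔ v ≠ w ∧ v ≠ z) ∧ ∀ a ∈ A, ∀ b ∈ B, ¬G.Adj a b) ∨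
    ∃ I : Finset V, 3 ≤ #I ∧ 2 * #I = Fintype.card V ∧ ∀ a ∈ I, ∀ b ∈ I, ¬G.Adj a b := by
  by_cases hex : ∃ q, IsCycleSeq G (Fintype.card V - 1) q ∧
      ∀ i, i < Fintype.card V - 1 → q i ≠ w
  · exact .inl hex
  right
  push Not at hex
  obtain ⟨p', hp'⟩ := exists_isCycleSeq_of_ore (G := G) (by lia) fun u v h h' => (hO u v h h').ge
  obtain ⟨a, ha, haw⟩ := hp'.2.1.surj_of_eq_card w
  obtain ⟨p, hp, hp0, -⟩ := hp'.exists_rotate ha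
  rw [haw] at hp0
  obtain ⟨N, hN⟩ : ∃ N, N = Fintype.card V - 1 := ⟨_, rfl⟩
  rw [← hN] at hex
  -- the path left after deleting `w` from the Hamiltonian cycle
  obtain ⟨q, hq⟩ : ∃ q : ℕ → V, ∀ i, q i = p (i + 1) := ⟨_, fun _ => rfl⟩
  have hqP : IsPathSeq G N q := by
    have : IsPathSeq G N (fun i => p (i + 1)) :=
      hp.2.1.reindex (fun i => i + 1) (by lia) (by lia) (by lia)
    rwa [← funext hq] at this
  have hqw : ∀ i, i < N → q i ≠ w := fun i hi h => by
    rw [hq, ← hp0] at h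
    have := hp.2.1.1 _ _ (by lia) (by lia) h
    lia
  have hqcov : ∀ v, v ≠ w → ∃ i, i < N ∧ q i = v := fun v hv => by
    obtain ⟨i, hi, rfl⟩ := hp.2.1.surj_of_eq_card v
    have : i ≠ 0 := by rintro rfl; exact hv hp0
    exact ⟨i - 1, by lia, by rw [hq]; congr 1; lia⟩
  have hxy : ¬G.Adj (q (N - 1)) (q 0) := fun h => by
    obtain ⟨i, hi, h'⟩ := hex q ⟨by lia, hqP, h⟩
    exact hqw i hi h'
  have hne : q 0 ≠ q (N - 1) := fun h => by
    have := hqP.1 _ _ (by lia) (by lia) h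
    lia
  have hdeg := hO _ _ hne fun h => hxy h.symm
  have hcov' : ∀ u v : V, G.Adj u v → v ∈ ({w} : Finset V) ∨ ∃ i, i < N ∧ q i = v := fun u v _ => by
    by_cases h : v = w
    · exact .inl (by simp [h])
    · exact .inr (hqcov v h)
  have hnocyc : ∀ f : ℕ → ℕ, (∀ i, i < N → f i < N) → ¬IsCycleSeq G N (fun i => q (f i)) :=
    fun f hf h => by
      obtain ⟨i, hi, h'⟩ := hex _ h
      exact hqw _ (hf i hi) h'
  rcases exists_crossing_or_forall (p := q) (by lia) {w} (hcov' _) (hcov' _)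
      (by rw [hdeg, card_singleton]; lia) with ⟨i, hi, h1, h2⟩ | ⟨hor, -⟩
  · exact absurd (hqP.isCycleSeq_of_crossing (by lia) hi h1 h2)
      (hnocyc _ fun j hj => by split_ifs <;> lia)
  by_cases hA : ∃ i, 1 ≤ i ∧ i + 1 < N ∧ G.Adj (q 0) (q (i + 1)) ∧ ¬G.Adj (q 0) (q i)
  · right
    obtain ⟨i, hi1, hi, ha1, ha2⟩ := hA
    have hb : G.Adj (q (N - 1)) (q (i - 1)) := by
      have := hor (i - 1) (by lia)
      rw [show i - 1 + 1 = i by lia] at this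
      exact this.resolve_left ha2
    have hi2 : 2 ≤ i := by
      by_contra hcon
      rw [show i - 1 = 0 by lia] at hb
      exact hxy hb
    obtain ⟨f, hf⟩ : ∃ f : ℕ → ℕ, ∀ j, f j = if j < i then j else N - 1 - (j - i) :=
      ⟨_, fun _ => rfl⟩
    have hfN : ∀ j, j < N - 1 → f j < N ∧ f j ≠ i := fun j hj => by
      rw [hf]; split_ifs <;> lia
    obtain ⟨c, hc⟩ : ∃ c : ℕ → V, ∀ j, c j = q (f j) := ⟨_, fun _ => rfl⟩
    have hcC : IsCycleSeq G (N - 1) c := by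
      have hP : IsPathSeq G (N - 1) (fun j => q (f j)) := by
        refine hqP.reindex f (fun j hj => (hfN j hj).1) (fun j k hj hk h => ?_) fun j hj => ?_
        · rw [hf, hf] at h
          split_ifs at h <;> lia
        · by_cases h : j + 1 = i
          · right; right
            rw [hf, hf, if_pos (by lia), if_neg (by lia)]
            convert hb.symm using 2 <;> lia
          · rw [hf, hf]
            split_ifs <;> lia
      rw [← funext hc] at hP
      refine ⟨by lia, hP, ?_⟩
      rw [hc, hc, hf, hf, if_neg (by lia), if_pos (by lia)]
      convert ha1.symm using 2
      lia
    refine exists_independent_of_isCycleSeq (s := q i) (w := w) (j := i - 1) (k := N - 2) hO hcC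
      (fun j hj h => ?_) (fun v => ?_) (fun r hr hr' => ?_) (by lia) (by lia) (by lia) ?_ ?_
    · rw [hc] at h
      exact (hfN j hj).2 (hqP.1 _ _ (hfN j hj).1 (by lia) h)
    · by_cases hv : v = w
      · exact .inl hv
      obtain ⟨j, hj, rfl⟩ := hqcov v hv
      right
      rcases lt_trichotomy j i with h | h | h
      · exact .inr ⟨j, by lia, by rw [hc, hf, if_pos h]⟩
      · exact .inl (by rw [h])
      · exact .inr ⟨N - 1 - (j - i), by lia, by rw [hc, hf, if_neg (by lia)]; congr 1; lia⟩
    · rw [show N - 1 + 1 = N by lia] at hr hr'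
      obtain ⟨j, hj, hjw⟩ := hex r hr
      rcases hr' j hj with h | ⟨k, hk, h⟩
      · exact hqw i (by lia) (h.symm.trans hjw)
      · exact hqw _ (hfN k hk).1 (by rw [← hc, ← h, hjw])
    · rw [hc, hf, if_pos (by lia)]
      exact hqP.adj_of_eq_succ (by lia) (by lia) (by lia)
    · rw [hc, hf, if_neg (by lia)]
      exact hqP.adj_of_eq_succ (by lia) (by lia) (by lia)
  · left
    push Not at hA
    have hexk : ∃ k, k + 1 < N ∧ ¬G.Adj (q 0) (q (k + 1)) :=
      ⟨N - 2, by lia, by rw [show N - 2 + 1 = N - 1 by lia]; exact fun h => hxy h.symm⟩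
    obtain ⟨k, hk⟩ : ∃ k, k = Nat.find hexk := ⟨_, rfl⟩
    obtain ⟨hkN, hka⟩ : k + 1 < N ∧ ¬G.Adj (q 0) (q (k + 1)) := hk ▸ Nat.find_spec hexk
    have hlow : ∀ i, i < k → G.Adj (q 0) (q (i + 1)) := fun i hi => by
      have := Nat.find_min hexk (hk ▸ hi)
      by_contra hcon
      exact this ⟨by lia, hcon⟩
    have hk1 : 1 ≤ k := by
      by_contra hcon
      rw [show k = 0 by lia] at hka
      exact hka (hqP.2 0 (by lia))
    have hhigh : ∀ i, k + i + 1 < N → ¬G.Adj (q 0) (q (k + i + 1)) := fun i => by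
      induction i with
      | zero => exact fun _ => hka
      | succ i ih => exact fun hi h => ih (by lia) (hA (k + i + 1) (by lia) (by lia) h)
    have hb : ∀ i, k ≤ i → i + 1 < N → G.Adj (q (N - 1)) (q i) := fun i hi hiN => by
      refine (hor i hiN).resolve_left ?_
      have := hhigh (i - k) (by lia)
      rwa [show k + (i - k) = i by lia] at this
    refine ⟨q k, hqw k (by lia), image q (range k), image q (Ico (k + 1) N),
      ⟨q 0, mem_image_of_mem _ (by simp; lia)⟩,
      ⟨q (N - 1), mem_image_of_mem _ (by simp; lia)⟩, ?_, fun v => ?_, ?_⟩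
    · rw [Finset.disjoint_left]
      rintro v hv hv'
      obtain ⟨i, hi, rfl⟩ := mem_image.1 hv
      obtain ⟨j, hj, h⟩ := mem_image.1 hv'
      simp only [Finset.mem_range, Finset.mem_Ico] at hi hj
      have := hqP.1 _ _ (by lia) (by lia) h
      lia
    · simp only [mem_union, mem_image, Finset.mem_range, Finset.mem_Ico]
      constructor
      · rintro (⟨i, hi, rfl⟩ | ⟨i, hi, rfl⟩)
        · exact ⟨hqw i (by lia), fun h => by have := hqP.1 _ _ (by lia) (by lia) h; lia⟩
        · exact ⟨hqw i (by lia), fun h => by have := hqP.1 _ _ (by lia) (by lia) h; lia⟩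
      · rintro ⟨hv, hvk⟩
        obtain ⟨i, hi, rfl⟩ := hqcov v hv
        have : i ≠ k := by rintro rfl; exact hvk rfl
        by_cases h : i < k
        · exact .inl ⟨i, h, rfl⟩
        · exact .inr ⟨i, by lia, rfl⟩
    · rintro u hu v hv h
      obtain ⟨j, hj, rfl⟩ := mem_image.1 hu
      obtain ⟨l, hl, rfl⟩ := mem_image.1 hv
      simp only [Finset.mem_range, Finset.mem_Ico] at hj hl
      exact absurd (hqP.isCycleSeq_of_chord (by lia) (by lia) (by lia) h (hlow j hj)
        (hb (l - 1) (by lia) (by lia))) (hnocyc _ fun i hi => by split_ifs <;> lia)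

end Structure

section TwoCliques

variable {V : Type*} [DecidableEq V] {G : SimpleGraph V}

/-- `G` is the join of an edge `uv` with the disjoint union of two nonempty cliques `A`, `B`. -/
def IsTwoCliqueJoin (G : SimpleGraph V) (u v : V) (A B : Finset V) : Prop :=
  u ≠ v ∧ A.Nonempty ∧ B.Nonempty ∧ Disjoint A B ∧ (∀ x, x ∈ A ∪ B ↔ x ≠ u ∧ x ≠ v) ∧
    ∀ x y, G.Adj x y ↔ x ≠ y ∧ ¬(x ∈ A ∧ y ∈ B) ∧ ¬(x ∈ B ∧ y ∈ A)

lemma IsTwoCliqueJoin.symm {u v : V} {A B : Finset V} (h : IsTwoCliqueJoin G u v A B) :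
    IsTwoCliqueJoin G u v B A := by
  obtain ⟨h1, h2, h3, h4, h5, h6⟩ := h
  refine ⟨h1, h3, h2, h4.symm, fun x => by rw [union_comm]; exact h5 x, fun x y => ?_⟩
  rw [h6]
  tauto

/-- A path leaving the clique `A` for `B` passes through one of the two cut vertices. -/
lemma IsTwoCliqueJoin.exists_cut_vertex {u v : V} {A B : Finset V} (h : IsTwoCliqueJoin G u v A B)
    {N : ℕ} {p : ℕ → V} (hp : IsPathSeq G N p) (h0 : p 0 ∈ A) {j : ℕ} (hj : j < N)
    (hjB : p j ∈ B) : ∃ i, i < j ∧ (p i = u ∨ p i = v) := by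
  obtain ⟨-, -, -, hAB, hmem, hadj⟩ := h
  by_contra! hcon
  have : ∀ i, i ≤ j → p i ∈ A := fun i => by
    induction i with
    | zero => exact fun _ => h0
    | succ i ih =>
      intro hi
      have hA := ih (by lia)
      have hnB : p (i + 1) ∉ B := fun hB => ((hadj _ _).1 (hp.2 i (by lia))).2.1 ⟨hA, hB⟩
      rcases hi.lt_or_eq with h | rfl
      · exact (mem_union.1 ((hmem _).2 (hcon _ h))).resolve_right hnB
      · exact absurd hjB hnB
  exact Finset.disjoint_left.1 hAB (this j le_rfl) hjB

variable [Fintype V]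

lemma card_add_card_add_two {w z : V} (hzw : z ≠ w) {A B : Finset V} (hAB : Disjoint A B)
    (hmem : ∀ v, v ∈ A ∪ B ↔ v ≠ w ∧ v ≠ z) : #A + #B + 2 = Fintype.card V := by
  have hcompl : A ∪ B = {w, z}ᶜ := by ext v; simp [-mem_union, hmem]
  have := card_compl ({w, z} : Finset V)
  rw [← hcompl, card_union_of_disjoint hAB, card_pair hzw.symm] at this
  have := card_le_univ ({w, z} : Finset V)
  rw [card_pair hzw.symm] at this
  lia

lemma IsTwoCliqueJoin.card_add_card {u v : V} {A B : Finset V} (h : IsTwoCliqueJoin G u v A B) :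
    #A + #B + 2 = Fintype.card V :=
  card_add_card_add_two h.1.symm h.2.2.2.1 h.2.2.2.2.1

/-- If all nonadjacent pairs have degree sum equal to the order, a graph with a cut of size two
is the join of an edge with two cliques. -/
lemma isTwoCliqueJoin_of_cut (hn : 5 ≤ Fintype.card V)
    (hO : ∀ u v : V, u ≠ v → ¬G.Adj u v → G.degree u + G.degree v = Fintype.card V)
    {w z : V} (hzw : z ≠ w) {A B : Finset V} (hA : A.Nonempty) (hB : B.Nonempty)
    (hAB : Disjoint A B) (hmem : ∀ v, v ∈ A ∪ B ↔ v ≠ w ∧ v ≠ z)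
    (hno : ∀ a ∈ A, ∀ b ∈ B, ¬G.Adj a b) : IsTwoCliqueJoin G w z A B := by
  have hcard := card_add_card_add_two hzw hAB hmem
  have hout : ∀ v, v ∉ A → v ∉ B → v = w ∨ v = z := fun v h1 h2 => by
    by_contra hcon
    push Not at hcon
    rcases mem_union.1 ((hmem v).2 hcon) with h | h
    · exact h1 h
    · exact h2 h
  have hwz : ∀ a ∈ A ∪ B, a ≠ w ∧ a ≠ z := fun a ha => (hmem a).1 ha
  have hsubA : ∀ a ∈ A, G.neighborFinset a ⊆ (A.erase a) ∪ {w, z} := fun a ha v hv => by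
    have hv' : G.Adj a v := by simpa using hv
    by_cases h : v ∈ A
    · exact mem_union_left _ (mem_erase.2 ⟨hv'.ne', h⟩)
    · refine mem_union_right _ ?_
      rcases hout v h fun hb => hno a ha v hb hv' with rfl | rfl <;> simp
  have hsubB : ∀ b ∈ B, G.neighborFinset b ⊆ (B.erase b) ∪ {w, z} := fun b hb v hv => by
    have hv' : G.Adj b v := by simpa using hv
    by_cases h : v ∈ B
    · exact mem_union_left _ (mem_erase.2 ⟨hv'.ne', h⟩)
    · refine mem_union_right _ ?_
      rcases hout v (fun ha => hno v ha b hb hv'.symm) h with rfl | rfl <;> simp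
  have hcardle : ∀ (C : Finset V), ∀ a ∈ C, #(C.erase a ∪ {w, z}) ≤ #C + 1 := fun C a ha => by
    refine (card_union_le _ _).trans ?_
    rw [card_pair hzw.symm, card_erase_of_mem ha]
    have := card_pos.2 ⟨a, ha⟩
    lia
  have hdeg : ∀ a ∈ A, ∀ b ∈ B, G.degree a + G.degree b = Fintype.card V := fun a ha b hb =>
    hO a b (fun h => Finset.disjoint_left.1 hAB ha (h ▸ hb)) (hno a ha b hb)
  have hdA : ∀ a ∈ A, G.degree a ≤ #A + 1 := fun a ha =>
    (card_le_card (hsubA a ha)).trans (hcardle A a ha)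
  have hdB : ∀ b ∈ B, G.degree b ≤ #B + 1 := fun b hb =>
    (card_le_card (hsubB b hb)).trans (hcardle B b hb)
  obtain ⟨a0, ha0⟩ := hA
  obtain ⟨b0, hb0⟩ := hB
  have hadjA : ∀ a ∈ A, ∀ v, v ≠ a → v ∉ B → G.Adj a v := fun a ha v hva hv => by
    have heq : G.neighborFinset a = A.erase a ∪ {w, z} := by
      refine eq_of_subset_of_card_le (hsubA a ha) ((hcardle A a ha).trans ?_)
      rw [G.card_neighborFinset_eq_degree]
      have := hdeg a ha b0 hb0
      have := hdB b0 hb0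
      lia
    rw [← mem_neighborFinset, heq]
    by_cases h : v ∈ A
    · simp [hva, h]
    · rcases hout v h hv with rfl | rfl <;> simp
  have hadjB : ∀ b ∈ B, ∀ v, v ≠ b → v ∉ A → G.Adj b v := fun b hb v hvb hv => by
    have heq : G.neighborFinset b = B.erase b ∪ {w, z} := by
      refine eq_of_subset_of_card_le (hsubB b hb) ((hcardle B b hb).trans ?_)
      rw [G.card_neighborFinset_eq_degree]
      have := hdeg a0 ha0 b hb
      have := hdA a0 ha0
      lia
    rw [← mem_neighborFinset, heq]
    by_cases h : v ∈ B
    · simp [hvb, h]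
    · rcases hout v hv h with rfl | rfl <;> simp
  have hfull : ∀ x, x = w ∨ x = z → #(A ∪ B) ≤ G.degree x := fun x hx => by
    rw [← G.card_neighborFinset_eq_degree]
    refine card_le_card fun v hv => ?_
    have hv' := hwz v hv
    have hxv : x ≠ v := by rcases hx with rfl | rfl; exacts [hv'.1.symm, hv'.2.symm]
    have hx' : x ∉ A ∪ B := fun h => by
      have := hwz x h
      rcases hx with h' | h'
      exacts [this.1 h', this.2 h']
    rw [mem_union, not_or] at hx'
    rw [mem_neighborFinset]
    rcases mem_union.1 hv with h | h
    · exact (hadjA v h x hxv hx'.2).symm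
    · exact (hadjB v h x hxv hx'.1).symm
  have hwzadj : G.Adj w z := by
    by_contra hcon
    have h1 := hO w z hzw.symm hcon
    have h2 := hfull w (.inl rfl)
    have h3 := hfull z (.inr rfl)
    rw [card_union_of_disjoint hAB] at h2 h3
    lia
  refine ⟨hzw.symm, ⟨a0, ha0⟩, ⟨b0, hb0⟩, hAB, hmem, fun x y => ⟨fun h => ⟨h.ne,
    fun hxy => hno x hxy.1 y hxy.2 h, fun hxy => hno y hxy.2 x hxy.1 h.symm⟩, ?_⟩⟩
  rintro ⟨hxy, h1, h2⟩
  by_cases hxA : x ∈ A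
  · exact hadjA x hxA y hxy.symm fun h => h1 ⟨hxA, h⟩
  by_cases hxB : x ∈ B
  · exact hadjB x hxB y hxy.symm fun h => h2 ⟨hxB, h⟩
  by_cases hyA : y ∈ A
  · exact (hadjA y hyA x hxy hxB).symm
  by_cases hyB : y ∈ B
  · exact (hadjB y hyB x hxy hxA).symm
  rcases hout x hxA hxB with rfl | rfl <;> rcases hout y hyA hyB with rfl | rfl
  · exact absurd rfl hxy
  · exact hwzadj
  · exact hwzadj.symm
  · exact absurd rfl hxy

lemma isHamiltonianCycle_of_card_le {x : V} {c : G.Walk x x} (hc : c.IsCycle)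
    (h : Fintype.card V ≤ c.length) : c.IsHamiltonianCycle :=
  Walk.isHamiltonianCycle_iff_isCycle_and_length_eq.2
    ⟨hc, (isCycleSeq_of_isCycle hc).1.2.1.le_card.antisymm h⟩

lemma IsTwoCliqueJoin.isHForceSet {u v : V} {A B : Finset V} (h : IsTwoCliqueJoin G u v A B) :
    IsHForceSet G (A ∪ B) := by
  have h' := h
  obtain ⟨huv, ⟨a, ha⟩, ⟨b, hb⟩, hAB, hmem, hadj⟩ := h'
  refine ⟨⟨a, mem_union_left _ ha⟩, fun x c hc hX => isHamiltonianCycle_of_card_le hc ?_⟩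
  obtain ⟨hseq, hsupp⟩ := isCycleSeq_of_isCycle hc
  obtain ⟨k, hk, hka⟩ := hsupp a (hX a (mem_union_left _ ha))
  obtain ⟨p, hp, hp0, hcov⟩ := hseq.exists_rotate hk
  set N := c.length
  rw [hka] at hp0
  have hX' : ∀ y ∈ A ∪ B, ∃ j, j < N ∧ p j = y := fun y hy => by
    obtain ⟨i, hi, rfl⟩ := hsupp y (hX y hy)
    exact hcov i hi
  obtain ⟨j, hj, hjb⟩ := hX' b (mem_union_right _ hb)
  obtain ⟨i1, hi1, h1⟩ := h.exists_cut_vertex hp.2.1 (hp0 ▸ ha) hj (hjb ▸ hb)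
  have hj0 : j ≠ 0 := by
    rintro rfl
    exact Finset.disjoint_left.1 hAB ha (by rw [← hp0, hjb]; exact hb)
  -- traverse the cycle in the opposite direction
  have hrev : IsPathSeq G N (fun i => p (if i = 0 then 0 else N - i)) := by
    refine hp.2.1.reindex _ (fun i hi => ?_) (fun i l hi hl h => ?_) fun i hi => ?_
    · split_ifs <;> lia
    · split_ifs at h <;> lia
    · by_cases h : i = 0
      · right; right
        subst h
        simpa using hp.2.2.symm
      · split_ifs <;> lia
  obtain ⟨i2, hi2, h2⟩ := h.exists_cut_vertex hrev (by simpa [hp0] using ha)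
    (j := N - j) (by lia) (by
      rw [if_neg (by lia), show N - (N - j) = j by lia, hjb]; exact hb)
  have hi20 : i2 ≠ 0 := by
    rintro rfl
    have := (hmem a).1 (mem_union_left _ ha)
    simp only [if_true, hp0] at h2
    tauto
  rw [if_neg hi20] at h2
  have hne : p i1 ≠ p (N - i2) := fun h => by
    have := hp.2.1.1 _ _ (by lia) (by lia) h
    lia
  have hall : ∀ y, ∃ j, j < N ∧ p j = y := fun y => by
    by_cases hy : y ∈ A ∪ B
    · exact hX' y hy
    rw [hmem] at hy
    by_cases h3 : p i1 = y
    · exact ⟨i1, by lia, h3⟩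
    · refine ⟨N - i2, by lia, ?_⟩
      rcases h1 with h1 | h1 <;> rcases h2 with h2 | h2 <;> grind
  have : (univ : Finset V) ⊆ image p (range N) := fun y _ => by
    obtain ⟨i, hi, h⟩ := hall y
    exact mem_image.2 ⟨i, by simpa using hi, h⟩
  have := (card_le_card this).trans card_image_le
  rwa [card_range, card_univ] at this

/-- An independent set containing half of the vertices is an H-force set. -/
lemma isHForceSet_of_independent {I : Finset V} (hI0 : I.Nonempty)
    (hI : 2 * #I = Fintype.card V) (hind : ∀ a ∈ I, ∀ b ∈ I, ¬G.Adj a b) : IsHForceSet G I := by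
  refine ⟨hI0, fun x c hc hX => isHamiltonianCycle_of_card_le hc ?_⟩
  obtain ⟨⟨h3, hP, hlast⟩, hsupp⟩ := isCycleSeq_of_isCycle hc
  set N := c.length
  set p := c.getVert
  set J := {i ∈ range N | p i ∈ I} with hJ
  have hmem : ∀ i, i ∈ J ↔ i < N ∧ p i ∈ I := by simp [hJ]
  have hIJ : #I ≤ #J := by
    have : I ⊆ image p J := fun y hy => by
      obtain ⟨i, hi, rfl⟩ := hsupp y (hX y hy)
      exact mem_image_of_mem _ ((hmem i).2 ⟨hi, hy⟩)
    exact (card_le_card this).trans card_image_le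
  obtain ⟨nxt, hnxt⟩ : ∃ f : ℕ → ℕ, ∀ i, f i = if i + 1 < N then i + 1 else 0 := ⟨_, fun _ => rfl⟩
  have hinj : #(image nxt J) = #J := card_image_of_injOn fun a ha b hb h => by
    have := ((hmem a).1 ha).1
    have := ((hmem b).1 hb).1
    rw [hnxt, hnxt] at h
    split_ifs at h <;> lia
  have hdisj : Disjoint J (image nxt J) := by
    rw [Finset.disjoint_left]
    rintro i hi hi'
    obtain ⟨k, hk, rfl⟩ := mem_image.1 hi'
    obtain ⟨h1, h2⟩ := (hmem k).1 hk
    obtain ⟨h1', h2'⟩ := (hmem _).1 hi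
    refine hind _ h2 _ h2' ?_
    rw [hnxt]
    split_ifs with h
    · exact hP.2 k h
    · convert hlast using 2; lia
  have hsub : J ∪ image nxt J ⊆ range N := by
    refine union_subset (filter_subset _ _) fun i hi => ?_
    obtain ⟨k, hk, rfl⟩ := mem_image.1 hi
    have := ((hmem k).1 hk).1
    rw [hnxt, Finset.mem_range]
    split_ifs <;> lia
  have := card_le_card hsub
  rw [card_union_of_disjoint hdisj, hinj, card_range] at this
  lia

/-- A vertex missed by a cycle through all other vertices lies in every H-force set. -/
lemma mem_of_isHForceSet {w : V} {q : ℕ → V} (hq : IsCycleSeq G (Fintype.card V - 1) q)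
    (hqw : ∀ i, i < Fintype.card V - 1 → q i ≠ w) {X : Finset V} (hX : IsHForceSet G X) :
    w ∈ X := by
  by_contra hw
  obtain ⟨v, c, hc, hlen, hsupp⟩ := hq.exists_isCycle
  have himg : image q (range (Fintype.card V - 1)) = univ.erase w := by
    refine eq_of_subset_of_card_le (fun y hy => ?_) ?_
    · obtain ⟨i, hi, rfl⟩ := mem_image.1 hy
      exact mem_erase.2 ⟨hqw i (by simpa using hi), mem_univ _⟩
    · rw [card_image_of_injOn, card_range, card_erase_of_mem (mem_univ _), card_univ]
      intro i hi j hj h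
      exact hq.2.1.1 i j (by simpa using hi) (by simpa using hj) h
  have hH := hX.2 v c hc fun x hx => (hsupp x).2 <| by
    have : x ∈ image q (range (Fintype.card V - 1)) := by
      rw [himg]
      exact mem_erase.2 ⟨fun h => hw (h ▸ hx), mem_univ _⟩
    simpa using this
  have := hH.length_eq
  have := hq.1
  lia

lemma IsTwoCliqueJoin.mem_of_isHForceSet (hn : 5 ≤ Fintype.card V)
    (hO : ∀ u v : V, u ≠ v → ¬G.Adj u v → G.degree u + G.degree v = Fintype.card V)
    {u v : V} {A B : Finset V} (h : IsTwoCliqueJoin G u v A B) {X : Finset V}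
    (hX : IsHForceSet G X) {w : V} (hw : w ∈ A ∪ B) : w ∈ X := by
  obtain ⟨huv, -, -, hAB, hmem, hadj⟩ := h
  have hfull : ∀ x, x = u ∨ x = v → ∀ y, x ≠ y → G.Adj x y := fun x hx y hxy => by
    have : x ∉ A ∪ B := by rw [hmem]; tauto
    rw [mem_union, not_or] at this
    rw [hadj]
    tauto
  rcases exists_cycle_avoiding_or_cut_or_independent hn hO w with ⟨q, hq, hqw⟩ |
    ⟨z, hzw, C, D, ⟨c, hc⟩, ⟨d, hd⟩, hCD, hCDm, hno⟩ | ⟨I, hI3, -, hI⟩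
  · exact _root_.mem_of_isHForceSet hq hqw hX
  · exfalso
    obtain ⟨x, hx, hxz⟩ : ∃ x, (x = u ∨ x = v) ∧ x ≠ z := by
      by_cases h : u = z
      · exact ⟨v, .inr rfl, fun h' => huv (h.trans h'.symm)⟩
      · exact ⟨u, .inl rfl, h⟩
    have hxw : x ≠ w := fun h => by
      have := (hmem w).1 hw
      rcases hx with h' | h'
      exacts [this.1 (h ▸ h'), this.2 (h ▸ h')]
    rcases mem_union.1 ((hCDm x).2 ⟨hxw, hxz⟩) with h | h
    · exact hno x h d hd (hfull x hx d fun h' => Finset.disjoint_left.1 hCD h (h' ▸ hd))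
    · exact hno c hc x h (hfull x hx c fun h' => Finset.disjoint_left.1 hCD hc (h' ▸ h)).symm
  · exfalso
    obtain ⟨x, hx, y, hy, z, hz, hxy, hxz, hyz⟩ := two_lt_card.1 hI3
    have hmemI : ∀ x ∈ I, ∀ y ∈ I, x ≠ y → x ∈ A ∧ y ∈ B ∨ x ∈ B ∧ y ∈ A := fun x hx y hy hxy => by
      have := hI x hx y hy
      rw [hadj] at this
      tauto
    have h1 := hmemI x hx y hy hxy
    have h2 := hmemI x hx z hz hxz
    have h3 := hmemI y hy z hz hyz
    have hd := Finset.disjoint_left.1 hAB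
    have hx' := @hd x
    have hy' := @hd y
    have hz' := @hd z
    tauto

end TwoCliques

section Isomorphism

variable {V : Type*} [DecidableEq V] {G : SimpleGraph V}

lemma IsTwoCliqueJoin.nonempty_iso {u v : V} {A B : Finset V} (h : IsTwoCliqueJoin G u v A B)
    {m k : ℕ} (hA : #A = m) (hB : #B = k) :
    Nonempty (G ≃g graphJoin (⊤ : SimpleGraph (Fin 2))
      ((⊤ : SimpleGraph (Fin m)) ⊕g (⊤ : SimpleGraph (Fin k)))) := by
  obtain ⟨huv, -, -, hAB, hmem, hadj⟩ := h
  let eA : Fin m ≃ A := (Finset.equivFinOfCardEq hA).symm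
  let eB : Fin k ≃ B := (Finset.equivFinOfCardEq hB).symm
  let φ : Fin 2 ⊕ (Fin m ⊕ Fin k) → V :=
    Sum.elim ![u, v] (Sum.elim (fun i => (eA i : V)) fun i => (eB i : V))
  have hnA : ∀ x, x ∈ A → x ≠ u ∧ x ≠ v ∧ x ∉ B := fun x hx =>
    ⟨((hmem x).1 (mem_union_left _ hx)).1, ((hmem x).1 (mem_union_left _ hx)).2,
      Finset.disjoint_left.1 hAB hx⟩
  have hnB : ∀ x, x ∈ B → x ≠ u ∧ x ≠ v ∧ x ∉ A := fun x hx =>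
    ⟨((hmem x).1 (mem_union_right _ hx)).1, ((hmem x).1 (mem_union_right _ hx)).2,
      Finset.disjoint_right.1 hAB hx⟩
  have hu : u ∉ A ∧ u ∉ B := ⟨fun h => (hnA u h).1 rfl, fun h => (hnB u h).1 rfl⟩
  have hv : v ∉ A ∧ v ∉ B := ⟨fun h => (hnA v h).2.1 rfl, fun h => (hnB v h).2.1 rfl⟩
  have hA' : ∀ i, (eA i : V) ∈ A := fun i => (eA i).2
  have hB' : ∀ i, (eB i : V) ∈ B := fun i => (eB i).2
  have hinj : Function.Injective φ := by
    rintro (s | s | s) (t | t | t) hst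
    · fin_cases s <;> fin_cases t <;> simp_all [φ]
    · exfalso; have := hnA _ (hA' t); fin_cases s <;> simp_all [φ]
    · exfalso; have := hnB _ (hB' t); fin_cases s <;> simp_all [φ]
    · exfalso; have := hnA _ (hA' s); fin_cases t <;> simp_all [φ]
    · simpa [φ, Subtype.ext_iff] using hst
    · exact absurd (hB' t) ((show (eA s : V) = eB t from hst) ▸ (hnA _ (hA' s)).2.2)
    · exfalso; have := hnB _ (hB' s); fin_cases t <;> simp_all [φ]
    · exact absurd (hA' t) ((show (eB s : V) = eA t from hst) ▸ (hnB _ (hB' s)).2.2)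
    · simpa [φ, Subtype.ext_iff] using hst
  have hsurj : Function.Surjective φ := by
    intro x
    by_cases hx : x ∈ A ∪ B
    · rcases mem_union.1 hx with hx | hx
      · exact ⟨.inr (.inl (eA.symm ⟨x, hx⟩)), by simp [φ]⟩
      · exact ⟨.inr (.inr (eB.symm ⟨x, hx⟩)), by simp [φ]⟩
    · rw [hmem] at hx
      by_cases hxu : x = u
      · exact ⟨.inl 0, by simp [φ, hxu]⟩
      · exact ⟨.inl 1, by simp only [φ, Sum.elim_inl]; simp; tauto⟩
  have hbij : Function.Bijective φ := ⟨hinj, hsurj⟩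
  refine ⟨RelIso.symm ⟨Equiv.ofBijective φ hbij, ?_⟩⟩
  intro s t
  rw [hadj]
  simp only [Equiv.ofBijective_apply, hinj.ne_iff]
  have hφ2 : ∀ i, φ (.inl i) ∉ A ∧ φ (.inl i) ∉ B := by
    intro i
    fin_cases i
    exacts [hu, hv]
  have hφA : ∀ i, φ (.inr (.inl i)) ∈ A ∧ φ (.inr (.inl i)) ∉ B := fun i =>
    ⟨hA' i, (hnA _ (hA' i)).2.2⟩
  have hφB : ∀ i, φ (.inr (.inr i)) ∉ A ∧ φ (.inr (.inr i)) ∈ B := fun i =>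
    ⟨(hnB _ (hB' i)).2.2, hB' i⟩
  rcases s with s | s | s <;> rcases t with t | t | t <;> simp [graphJoin, hφ2, hφA, hφB]

variable [Fintype V]

lemma exists_isTwoCliqueJoin_of_iso {m k : ℕ} (hm : 1 ≤ m) (hk : 1 ≤ k)
    (e : G ≃g graphJoin (⊤ : SimpleGraph (Fin 2))
      ((⊤ : SimpleGraph (Fin m)) ⊕g (⊤ : SimpleGraph (Fin k)))) :
    ∃ u v A B, IsTwoCliqueJoin G u v A B := by
  refine ⟨e.symm (.inl 0), e.symm (.inl 1), ({x | ∃ i, e x = .inr (.inl i)} : Finset V),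
    ({x | ∃ i, e x = .inr (.inr i)} : Finset V), ?_, ?_, ?_, ?_, fun x => ?_, fun x y => ?_⟩
  · simp
  · exact ⟨e.symm (.inr (.inl ⟨0, hm⟩)), by simp⟩
  · exact ⟨e.symm (.inr (.inr ⟨0, hk⟩)), by simp⟩
  · rw [Finset.disjoint_left]
    intro x hx hx'
    obtain ⟨i, hi⟩ := (mem_filter.1 hx).2
    obtain ⟨j, hj⟩ := (mem_filter.1 hx').2
    rw [hi] at hj
    simp at hj
  · obtain ⟨t, rfl⟩ := e.symm.surjective x
    rcases t with t | t | t
    · fin_cases t <;> simp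
    · simp
    · simp
  · obtain ⟨s, rfl⟩ := e.symm.surjective x
    obtain ⟨t, rfl⟩ := e.symm.surjective y
    rw [e.symm.map_adj_iff, e.symm.injective.ne_iff]
    simp only [mem_filter, Finset.mem_univ, true_and, RelIso.apply_symm_apply]
    rcases s with s | s | s <;> rcases t with t | t | t <;> simp [graphJoin]

end Isomorphism

section WeakClosure

variable {V : Type*} [Fintype V]

lemma IsOTG.mono {G H : SimpleGraph V} (hG : IsOTG G) (h : G ≤ H) : IsOTG H := fun u v huv hna =>
  (hG u v huv fun h' => hna (h h')).trans
    (add_le_add (degree_le_of_le h) (degree_le_of_le h))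

lemma IsWeakClosure.degree_add_degree {G H : SimpleGraph V} (hG : IsOTG G)
    (h : IsWeakClosure G H) (u v : V) (huv : u ≠ v) (hna : ¬H.Adj u v) :
    H.degree u + H.degree v = Fintype.card V := by
  have hle : G ≤ H := by
    refine Relation.ReflTransGen.head_induction_on h.1 le_rfl fun hstep _ ih => ?_
    obtain ⟨_, _, -, -, -, rfl⟩ := hstep
    exact le_sup_left.trans ih
  have h1 := hG.mono hle u v huv hna
  have h2 := h.2 u v huv hna
  lia

end WeakClosure

/-- For the weak closure `Gw` of an OTG with `n ≥ 5` vertices, `h(Gw) = n - 2` iff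
`Gw ≅ K_2 ∨ (K_m + K_{n-m-2})` for some `1 ≤ m < n / 2`. -/
theorem stmt_11 {V : Type*} [Fintype V] [DecidableEq V] (Gw : SimpleGraph V) (n : ℕ)
    (hcard : Fintype.card V = n) (hn : 5 ≤ n)
    (hGw : ∃ G : SimpleGraph V, IsOTG G ∧ IsWeakClosure G Gw) :
    hForce Gw = n - 2 ↔
      ∃ m : ℕ, 1 ≤ m ∧ 2 * m < n ∧
        Nonempty (Gw ≃g graphJoin (⊤ : SimpleGraph (Fin 2))
          ((⊤ : SimpleGraph (Fin m)) ⊕g (⊤ : SimpleGraph (Fin (n - m - 2))))) := by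
  obtain ⟨G, hG, hw⟩ := hGw
  have hO := hw.degree_add_degree hG
  subst hcard
  constructor
  · intro hh
    have hne : {k | ∃ X : Finset V, IsHForceSet Gw X ∧ X.card = k}.Nonempty := by
      by_contra hcon
      rw [Set.not_nonempty_iff_eq_empty] at hcon
      rw [hForce, hcon, Nat.sInf_empty] at hh
      lia
    obtain ⟨X, hX, hXcard⟩ : ∃ X : Finset V, IsHForceSet Gw X ∧ X.card = hForce Gw :=
      Nat.sInf_mem hne
    obtain ⟨w, hwX⟩ : ∃ w, w ∉ X := by
      by_contra! hcon
      rw [eq_univ_iff_forall.2 hcon, card_univ] at hXcard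
      lia
    rcases exists_cycle_avoiding_or_cut_or_independent hn hO w with ⟨q, hq, hqw⟩ |
      ⟨z, hzw, A, B, hA, hB, hAB, hmem, hno⟩ | ⟨I, hI3, hI2, hI⟩
    · exact absurd (mem_of_isHForceSet hq hqw hX) hwX
    · have h := isTwoCliqueJoin_of_cut hn hO hzw hA hB hAB hmem hno
      have hcard := h.card_add_card
      have hA' := hA.card_pos
      have hB' := hB.card_pos
      rcases le_total #A #B with hle | hle
      · exact ⟨#A, by lia, by lia, h.nonempty_iso rfl (by lia)⟩
      · exact ⟨#B, by lia, by lia, h.symm.nonempty_iso rfl (by lia)⟩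
    · have : hForce Gw ≤ #I :=
        Nat.sInf_le ⟨I, isHForceSet_of_independent (card_pos.1 (by lia)) hI2 hI, rfl⟩
      lia
  · rintro ⟨m, hm, hmn, ⟨e⟩⟩
    obtain ⟨u, v, A, B, h⟩ := exists_isTwoCliqueJoin_of_iso hm (by lia) e
    have hcard := h.card_add_card
    have hunion : #(A ∪ B) = Fintype.card V - 2 := by
      rw [card_union_of_disjoint h.2.2.2.1]
      lia
    refine le_antisymm (Nat.sInf_le ⟨_, h.isHForceSet, hunion⟩)
      (le_csInf ⟨_, _, h.isHForceSet, rfl⟩ ?_)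
    rintro k ⟨X, hX, rfl⟩
    rw [← hunion]
    exact card_le_card fun w hw => h.mem_of_isHForceSet hn hO hX hw
end
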